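/- arXiv:2005.00099 — 2 statements merged into one kernel-verified Lean document; each statement's English description precedes it below -/
import Mathlib

section
/- Let k ≥ 3 be odd and n ≥ 1. Then for every real number q, Σ_{(σ_1,…,σ_k) ∈ S_n^k} q^{C(σ_1⋯σ_k·σ_1⁻¹⋯σ_k⁻¹)} = (n!)² · Σ_{λ ⊢ n} H_λ^{k−3} · Π_{(i,j) ∈ λ} (q + j − i), where the sum is over partitions λ of n, H_λ is the product of the hook lengths of all cells of λ, and the product is over cells (i,j) of the Young diagram of λ (with content j − i). -/
/-- Number of cycles of a permutation of `Fin n`, counting fixed points as 1-cycles. -/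
def numCycles {n : ℕ} (π : Equiv.Perm (Fin n)) : ℕ :=
  Multiset.card π.cycleType + (Finset.univ.filter fun i => π i = i).card

/-- `w_c(σ_1, …, σ_k) = σ_1 ⋯ σ_k · σ_1⁻¹ ⋯ σ_k⁻¹`. -/
def wc {n k : ℕ} (v : Fin k → Equiv.Perm (Fin n)) : Equiv.Perm (Fin n) :=
  (List.ofFn v).prod * (List.ofFn fun i => (v i)⁻¹).prod

/-- For a partition `lam` of `n` with parts sorted in decreasing order, the product
over the cells `(a,b)` (`0`-indexed) of the Young diagram of `q + content(a,b)`,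
where the content of cell `(a,b)` is `b - a`. -/
noncomputable def contentProd (q : ℝ) {n : ℕ} (lam : Nat.Partition n) : ℝ :=
  let L := lam.parts.sort (· ≥ ·)
  ∏ a ∈ Finset.range L.length, ∏ b ∈ Finset.range (L.getD a 0),
    (q + (b : ℝ) - (a : ℝ))

/-- The product `H_λ` of the hook lengths of all cells of the partition `lam`:
the hook length of the `0`-indexed cell `(a,b)` is `λ_a - b + λ'_b - a - 1`
(with `1`-indexed conventions this is `λ_i - j + λ'_j - i + 1`). -/
def hookProd {n : ℕ} (lam : Nat.Partition n) : ℕ :=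
  let L := lam.parts.sort (· ≥ ·)
  ∏ a ∈ Finset.range L.length, ∏ b ∈ Finset.range (L.getD a 0),
    (L.getD a 0 + ((Finset.range L.length).filter fun a' => b < L.getD a' 0).card - a - b - 1)

section part1
open Finset

noncomputable def yy (f : ℕ → ℕ) (i : ℕ) : ℝ := (f i : ℝ) - i

noncomputable def ww (n : ℕ) (f : ℕ → ℕ) (k : ℕ) : ℝ :=
  (∏ i ∈ range n, (yy f k - yy f i + 1)) / ∏ i ∈ (range (n+1)).erase k, (yy f k - yy f i)

noncomputable def HH (n : ℕ) (f : ℕ → ℕ) : ℝ :=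
  (∏ i ∈ range (n+1), ((f i + n - i).factorial : ℝ)) /
    ∏ i ∈ range (n+1), ∏ j ∈ range i, (yy f j - yy f i)

noncomputable def mm (n : ℕ) (f : ℕ → ℕ) (p : ℕ) : ℝ :=
  ∑ k ∈ range (n+1), ww n f k * yy f k ^ p

def Addb (f : ℕ → ℕ) (k : ℕ) : Prop := ∀ i < k, f k < f i

def upd (f : ℕ → ℕ) (k : ℕ) : ℕ → ℕ := Function.update f k (f k + 1)

theorem yy_lt {f : ℕ → ℕ} (hf : Antitone f) {i j : ℕ} (h : i < j) : yy f j < yy f i := by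
  unfold yy
  have h1 : (f j : ℝ) ≤ f i := by exact_mod_cast hf h.le
  have h2 : (i : ℝ) < j := by exact_mod_cast h
  linarith

theorem yy_inj {f : ℕ → ℕ} (hf : Antitone f) : Function.Injective (yy f) := by
  intro i j h
  rcases lt_trichotomy i j with h1 | h1 | h1
  · exact absurd h (yy_lt hf h1).ne'
  · exact h1
  · exact absurd h (yy_lt hf h1).ne

theorem yy_upd_self (f : ℕ → ℕ) (k : ℕ) : yy (upd f k) k = yy f k + 1 := by
  simp [yy, upd]; ring

theorem yy_upd_ne (f : ℕ → ℕ) {k i : ℕ} (h : i ≠ k) : yy (upd f k) i = yy f i := by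
  simp [yy, upd, h]

theorem upd_anti {f : ℕ → ℕ} (hf : Antitone f) {k : ℕ} (h : Addb f k) : Antitone (upd f k) := by
  intro i j hij
  unfold upd
  by_cases h1 : j = k
  · subst h1
    by_cases h2 : i = j
    · subst h2; simp
    · have := h i (by omega)
      simp [h2]; omega
  · by_cases h2 : i = k
    · subst h2; simp [h1]; have := hf hij; omega
    · simp [h1, h2]; exact hf hij

section rev
open Polynomial

theorem reflect_prod (s : Finset ℕ) (a : ℕ → ℝ) :
    reflect s.card (∏ i ∈ s, (X - C (a i))) = ∏ i ∈ s, (1 - C (a i) * X) := by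
  induction s using Finset.induction_on with
  | empty => simp
  | insert i s hi ih =>
    rw [Finset.prod_insert hi, Finset.prod_insert hi, ← ih, Finset.card_insert_of_notMem hi,
      add_comm s.card 1, reflect_mul]
    · congr 1
      rw [reflect_sub, reflect_C]
      have : reflect 1 (X : ℝ[X]) = 1 := by simp
      rw [this]; simp
    · exact natDegree_X_sub_C_le _
    · rw [natDegree_prod_of_monic _ _ (fun i _ => monic_X_sub_C _)]
      simp

theorem lag (s : Finset ℕ) (y : ℕ → ℝ) (hy : Set.InjOn y s) (Q : ℝ[X]) (hQ : Q.degree < s.card) :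
    Q = ∑ k ∈ s, C (Q.eval (y k) / ∏ i ∈ s.erase k, (y k - y i)) *
      ∏ i ∈ s.erase k, (X - C (y i)) := by
  conv_lhs => rw [Lagrange.eq_interpolate hy hQ, Lagrange.interpolate_apply]
  refine Finset.sum_congr rfl fun k hk => ?_
  rw [Lagrange.basis, div_eq_mul_inv, C_mul, mul_assoc]
  congr 1
  simp only [Lagrange.basisDivisor]
  rw [Finset.prod_mul_distrib, ← map_prod, Finset.prod_inv_distrib]

theorem lag_rev (s : Finset ℕ) (y : ℕ → ℝ) (hy : Set.InjOn y s) (Q : ℝ[X])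
    (hQ : Q.degree < s.card) :
    reflect (s.card - 1) Q = ∑ k ∈ s, C (Q.eval (y k) / ∏ i ∈ s.erase k, (y k - y i)) *
      ∏ i ∈ s.erase k, (1 - C (y i) * X) := by
  conv_lhs => rw [lag s y hy Q hQ]
  have : ∀ (t : Finset ℕ) (g : ℕ → ℝ[X]) (N : ℕ), reflect N (∑ i ∈ t, g i) = ∑ i ∈ t, reflect N (g i) := by
    intro t g N
    induction t using Finset.induction_on with
    | empty => simp
    | insert i t hi ih => rw [Finset.sum_insert hi, Finset.sum_insert hi, reflect_add, ih]
  rw [this]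
  refine Finset.sum_congr rfl fun k hk => ?_
  rw [reflect_C_mul, ← reflect_prod, Finset.card_erase_of_mem hk]

theorem mm_series_poly (n : ℕ) (f : ℕ → ℕ) (hf : Antitone f) :
    ∑ k ∈ range (n+1), C (ww n f k) * ∏ i ∈ (range (n+1)).erase k, (1 - C (yy f i) * X)
      = ∏ i ∈ range n, (1 - C (yy f i - 1) * X) := by
  have h := lag_rev (range (n+1)) (yy f) ((yy_inj hf).injOn)
    (∏ i ∈ range n, (X - C (yy f i - 1))) (by
      rw [degree_prod_of_monic _ _ (fun i _ => monic_X_sub_C _)]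
      simp only [degree_X_sub_C, Finset.sum_const, card_range, nsmul_eq_mul, mul_one]
      exact_mod_cast Nat.lt_succ_self n)
  have h2 := reflect_prod (range n) (fun i => yy f i - 1)
  rw [card_range] at h h2
  rw [Nat.add_sub_cancel, h2] at h
  rw [h]
  refine Finset.sum_congr rfl fun k hk => ?_
  congr 2
  rw [eval_prod, ww]
  congr 1
  refine Finset.prod_congr rfl fun i _ => ?_
  simp; ring

end rev

section ps
open PowerSeries

noncomputable def MM (n : ℕ) (f : ℕ → ℕ) : PowerSeries ℝ := PowerSeries.mk (mm n f)

noncomputable def lin (a : ℝ) : PowerSeries ℝ := 1 - C a * X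

theorem lin_ne (a : ℝ) : lin a ≠ 0 := by
  intro h
  have := congrArg (coeff 0) h
  simp [lin] at this

theorem lin_geom (a : ℝ) : lin a * PowerSeries.mk (fun k => a ^ k) = 1 := by
  ext k
  cases k with
  | zero => simp [lin]
  | succ k =>
    simp only [lin, sub_mul, one_mul, map_sub, coeff_mk, coeff_one]
    rw [mul_assoc, coeff_C_mul, coeff_succ_X_mul, coeff_mk]
    simp [pow_succ]; ring

theorem MM_eq (n : ℕ) (f : ℕ → ℕ) (hf : Antitone f) :
    MM n f * ∏ i ∈ range (n+1), lin (yy f i) = ∏ i ∈ range n, lin (yy f i - 1) := by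
  have h1 : MM n f = ∑ k ∈ range (n+1), C (ww n f k) * PowerSeries.mk (fun p => yy f k ^ p) := by
    ext p
    rw [map_sum]
    simp [MM, mm, coeff_C_mul]
  have h2 := congrArg (fun P : Polynomial ℝ => (Polynomial.coeToPowerSeries.ringHom P : PowerSeries ℝ))
    (mm_series_poly n f hf)
  simp only [map_sum, map_mul, map_prod, map_sub, map_one,
    Polynomial.coeToPowerSeries.ringHom_apply, Polynomial.coe_C, Polynomial.coe_X] at h2
  have h3 : ∏ i ∈ range n, lin (yy f i - 1) = ∏ i ∈ range n, (1 - (C (yy f i) - 1) * X) := by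
    refine Finset.prod_congr rfl fun i _ => ?_
    simp [lin]
  rw [h3, ← h2, h1, Finset.sum_mul]
  refine Finset.sum_congr rfl fun k hk => ?_
  rw [← Finset.mul_prod_erase _ _ hk, mul_assoc, ← mul_assoc (PowerSeries.mk _),
    mul_comm (PowerSeries.mk _), lin_geom, one_mul]
  rfl

theorem MM_zero (n : ℕ) : MM n (fun _ => 0) = 1 := by
  have h := MM_eq n (fun _ => 0) (fun _ _ _ => le_rfl)
  rw [Finset.prod_range_succ'] at h
  have h0 : lin (yy (fun _ => 0) 0) = 1 := by simp [yy, lin]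
  rw [h0, mul_one] at h
  have h1 : ∏ k ∈ range n, lin (yy (fun _ => 0) (k+1)) = ∏ i ∈ range n, lin (yy (fun _ => 0) i - 1) := by
    refine Finset.prod_congr rfl fun i _ => ?_
    congr 1
    simp [yy]; ring
  rw [h1] at h
  exact mul_right_cancel₀ (Finset.prod_ne_zero_iff.2 fun i _ => lin_ne _) (h.trans (one_mul _).symm)

theorem MM_step (n : ℕ) (f : ℕ → ℕ) (hf : Antitone f) (k : ℕ) (hk : k < n) (ha : Addb f k) :
    MM n f * lin (yy f k) ^ 2 = MM n (upd f k) * (lin (yy f k - 1) * lin (yy f k + 1)) := by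
  have h1 := MM_eq n f hf
  have h2 := MM_eq n _ (upd_anti hf ha)
  rw [← Finset.mul_prod_erase _ _ (show k ∈ range (n+1) by simp; omega),
    ← Finset.mul_prod_erase _ _ (show k ∈ range n by simpa)] at h1 h2
  rw [yy_upd_self] at h2
  have e1 : ∏ x ∈ (range (n+1)).erase k, lin (yy (upd f k) x) = ∏ x ∈ (range (n+1)).erase k, lin (yy f x) :=
    Finset.prod_congr rfl fun i hi => by rw [yy_upd_ne f (Finset.ne_of_mem_erase hi)]
  have e2 : ∏ x ∈ (range n).erase k, lin (yy (upd f k) x - 1) = ∏ x ∈ (range n).erase k, lin (yy f x - 1) :=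
    Finset.prod_congr rfl fun i hi => by rw [yy_upd_ne f (Finset.ne_of_mem_erase hi)]
  rw [e1, e2, add_sub_cancel_right] at h2
  have hD : ∏ x ∈ (range (n+1)).erase k, lin (yy f x) ≠ 0 :=
    Finset.prod_ne_zero_iff.2 fun i _ => lin_ne _
  apply mul_right_cancel₀ hD
  linear_combination lin (yy f k) * h1 - lin (yy f k - 1) * h2

/-- scalar recursion -/
theorem mm_step (n : ℕ) (f : ℕ → ℕ) (hf : Antitone f) (k : ℕ) (hk : k < n) (ha : Addb f k)
    (d h : ℕ → ℝ) (d0 : d 0 = 0) (h0 : h 0 = 0)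
    (d1 : ∀ p, d (p+1) = mm n (upd f k) p + yy f k * d p)
    (h1 : ∀ p, h (p+1) = d p + yy f k * h p) (p : ℕ) :
    mm n f p = mm n (upd f k) p - h p := by
  have key : ∀ (u v : ℕ → ℝ) (x : ℝ), u 0 = 0 → (∀ p, u (p+1) = v p + x * u p) →
      PowerSeries.mk u * lin x = X * PowerSeries.mk v := by
    intro u v x u0 u1
    rw [mul_comm]
    ext p
    cases p with
    | zero => simp [lin, u0]
    | succ p =>
      simp only [lin, sub_mul, one_mul, map_sub, coeff_mk]
      rw [mul_assoc, coeff_C_mul, coeff_succ_X_mul, coeff_succ_X_mul, coeff_mk, coeff_mk, u1]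
      ring
  have k1 := key d _ _ d0 d1
  have k2 := key h _ _ h0 h1
  have k3 := MM_step n f hf k hk ha
  have : MM n f = MM n (upd f k) - PowerSeries.mk h := by
    apply mul_right_cancel₀ (pow_ne_zero 2 (lin_ne (yy f k)))
    have e : lin (yy f k - 1) * lin (yy f k + 1) = lin (yy f k) ^ 2 - X ^ 2 := by
      simp [lin]; ring
    rw [k3, e]
    have k1' : PowerSeries.mk d * lin (yy f k) = X * MM n (upd f k) := k1
    linear_combination lin (yy f k) * k2 + X * k1'
  have := congrArg (coeff p) this
  simpa [MM] using this

end ps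

end part1

section part2
open Finset

section lb
open Polynomial

theorem coeff_prods (s : Finset ℕ) (a : ℕ → ℝ) :
    (∏ i ∈ s, (1 - C (a i) * X : ℝ[X])).coeff 0 = 1 ∧
    (∏ i ∈ s, (1 - C (a i) * X : ℝ[X])).coeff 1 = - ∑ i ∈ s, a i ∧
    (∏ i ∈ s, (1 - C (a i + 1) * X : ℝ[X])).coeff 2 - (∏ i ∈ s, (1 - C (a i) * X : ℝ[X])).coeff 2
      = ((s.card : ℝ) - 1) * ∑ i ∈ s, a i + s.card * (s.card - 1) / 2 := by
  induction s using Finset.induction_on generalizing a with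
  | empty => simp [coeff_one]
  | insert i s hi ih =>
    have H : ∀ (b : ℝ) (P : ℝ[X]) (n : ℕ), ((1 - C b * X) * P).coeff (n+1) = P.coeff (n+1) - b * P.coeff n := by
      intro b P n
      rw [sub_mul, one_mul, coeff_sub, mul_assoc, coeff_C_mul, coeff_X_mul]
    obtain ⟨h0, h1, h2⟩ := ih a
    obtain ⟨h0', h1', -⟩ := ih (fun i => a i + 1)
    refine ⟨?_, ?_, ?_⟩
    · rw [Finset.prod_insert hi, mul_coeff_zero, h0]; simp
    · rw [Finset.prod_insert hi, H, h0, h1, Finset.sum_insert hi]; ring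
    · rw [Finset.prod_insert hi, Finset.prod_insert hi, H, H, h1, h1', Finset.sum_insert hi,
        Finset.card_insert_of_notMem hi, Finset.sum_add_distrib]
      push_cast
      simp only [Finset.sum_const, nsmul_eq_mul, mul_one]
      linear_combination h2

theorem hook_id (s : Finset ℕ) (x : ℕ → ℝ) (hx : Set.InjOn x s) :
    ∑ k ∈ s, x k * ((∏ i ∈ s.erase k, (x k - x i - 1)) / ∏ i ∈ s.erase k, (x k - x i))
      = ∑ k ∈ s, x k - s.card * (s.card - 1) / 2 := by
  rcases s.eq_empty_or_nonempty with rfl | hs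
  · simp
  set A : ℕ → ℝ := fun k => (∏ i ∈ s.erase k, (x k - x i - 1)) / ∏ i ∈ s.erase k, (x k - x i) with hA
  set Q : ℝ[X] := ∏ i ∈ s, (X - C (x i)) - ∏ i ∈ s, (X - C (x i + 1)) with hQdef
  have m1 : (∏ i ∈ s, (X - C (x i))).Monic := monic_prod_of_monic _ _ (fun i _ => monic_X_sub_C _)
  have m2 : (∏ i ∈ s, (X - C (x i + 1))).Monic := monic_prod_of_monic _ _ (fun i _ => monic_X_sub_C _)
  have d1 : (∏ i ∈ s, (X - C (x i))).degree = (s.card : WithBot ℕ) := by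
    rw [Polynomial.degree_eq_natDegree (Monic.ne_zero (by assumption)), natDegree_prod_of_monic _ _ (fun i _ => monic_X_sub_C _)]
    simp
  have d2 : (∏ i ∈ s, (X - C (x i + 1))).degree = (s.card : WithBot ℕ) := by
    rw [Polynomial.degree_eq_natDegree (Monic.ne_zero (by assumption)), natDegree_prod_of_monic _ _ (fun i _ => monic_X_sub_C _)]
    simp only [natDegree_X_sub_C]; simp
  have hQ : Q.degree < s.card := by
    rw [← d1]
    exact degree_sub_lt (d1.trans d2.symm) m1.ne_zero (by rw [m1.leadingCoeff, m2.leadingCoeff])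
  have hev : ∀ k ∈ s, Q.eval (x k) / ∏ i ∈ s.erase k, (x k - x i) = A k := by
    intro k hk
    simp only [hA]
    congr 1
    rw [hQdef, eval_sub, eval_prod, eval_prod, ← Finset.mul_prod_erase _ _ hk,
      ← Finset.mul_prod_erase s (fun i => eval (x k) (X - C (x i + 1))) hk]
    simp only [eval_sub, eval_X, eval_C, sub_self, zero_mul, zero_sub]
    rw [show x k - (x k + 1) = -1 by ring, neg_one_mul, neg_neg]
    exact Finset.prod_congr rfl fun i _ => by ring
  have h := lag s x hx Q hQ
  have h' : reflect s.card Q = ∑ k ∈ s, C (A k) * (X * ∏ i ∈ s.erase k, (1 - C (x i) * X)) := by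
    conv_lhs => rw [h]
    have : ∀ (t : Finset ℕ) (g : ℕ → ℝ[X]) (N : ℕ), reflect N (∑ i ∈ t, g i) = ∑ i ∈ t, reflect N (g i) := by
      intro t g N
      induction t using Finset.induction_on with
      | empty => simp
      | insert i t hi ih => rw [Finset.sum_insert hi, Finset.sum_insert hi, reflect_add, ih]
    rw [this]
    refine Finset.sum_congr rfl fun k hk => ?_
    rw [reflect_C_mul, ← reflect_prod, hev k hk]
    congr 1
    have hc : s.card = 1 + (s.erase k).card := by
      rw [Finset.card_erase_of_mem hk]
      have := Finset.card_pos.2 hs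
      omega
    rw [hc]
    conv_lhs => rw [← one_mul (∏ i ∈ s.erase k, (X - C (x i)))]
    rw [reflect_mul _ _ (by simp)]
    · congr 1
      have := reflect_monomial (R := ℝ) 1 0
      simpa using this
    · rw [natDegree_prod_of_monic _ _ (fun i _ => monic_X_sub_C _)]
      simp
  rw [hQdef, reflect_sub, reflect_prod, reflect_prod s (fun i => x i + 1)] at h'
  have c1 := congrArg (fun P => coeff P 1) h'
  have c2 := congrArg (fun P => coeff P 2) h'
  simp only [coeff_sub, finset_sum_coeff, coeff_C_mul] at c1 c2
  obtain ⟨p0, p1, p2⟩ := coeff_prods s x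
  obtain ⟨q0, q1, -⟩ := coeff_prods s (fun i => x i + 1)
  rw [p1, q1] at c1
  have e1 : ∀ k ∈ s, A k * (X * ∏ i ∈ s.erase k, (1 - C (x i) * X) : ℝ[X]).coeff 1 = A k := by
    intro k hk
    rw [show (1:ℕ) = 0 + 1 from rfl, coeff_X_mul, (coeff_prods (s.erase k) x).1, mul_one]
  have e2 : ∀ k ∈ s, A k * (X * ∏ i ∈ s.erase k, (1 - C (x i) * X) : ℝ[X]).coeff 2
      = x k * A k - A k * ∑ i ∈ s, x i := by
    intro k hk
    rw [show (2:ℕ) = 1 + 1 from rfl, coeff_X_mul, (coeff_prods (s.erase k) x).2.1,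
      ← Finset.add_sum_erase s x hk]
    ring
  rw [Finset.sum_congr rfl e1, Finset.sum_add_distrib] at c1
  rw [Finset.sum_congr rfl e2, Finset.sum_sub_distrib, ← Finset.sum_mul, ← c1] at c2
  simp only [Finset.sum_const, nsmul_eq_mul, mul_one] at c2
  change ∑ k ∈ s, x k * A k = _
  linear_combination - c2 - p2

end lb

theorem ww_not_add (n : ℕ) (f : ℕ → ℕ) (hf : Antitone f) (k : ℕ) (hk : k ≤ n) (h : ¬ Addb f k) :
    ww n f k = 0 := by
  unfold Addb at h
  push Not at h
  obtain ⟨i, hik, hfi⟩ := h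
  have h1 : f (k-1) = f k := le_antisymm ((hf (show i ≤ k - 1 by omega)).trans hfi) (hf (by omega))
  rw [ww, Finset.prod_eq_zero (i := k-1), zero_div]
  · simp; omega
  · unfold yy
    rw [h1, Nat.cast_sub (by omega)]
    push_cast; ring

theorem vand_ne (n : ℕ) (f : ℕ → ℕ) (hf : Antitone f) :
    0 < ∏ i ∈ range (n+1), ∏ j ∈ range i, (yy f j - yy f i) :=
  Finset.prod_pos fun i _ => Finset.prod_pos fun j hj => sub_pos.2 (yy_lt hf (by simpa using hj))

theorem HH_pos (n : ℕ) (f : ℕ → ℕ) (hf : Antitone f) : 0 < HH n f := by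
  refine div_pos (Finset.prod_pos fun i _ => ?_) (vand_ne n f hf)
  exact_mod_cast Nat.factorial_pos _

/-- vandermonde split at `k` -/
theorem vand_split (n : ℕ) (y : ℕ → ℝ) (k : ℕ) (hk : k ≤ n) :
    ∃ c : ℝ, ∃ ε : ℝ, ε ≠ 0 ∧ (∀ z : ℝ,
      ∏ i ∈ range (n+1), ∏ j ∈ range i, (Function.update y k z j - Function.update y k z i)
       = c * ε * ∏ i ∈ (range (n+1)).erase k, (z - y i)) := by
  induction n with
  | zero =>
    have : k = 0 := by omega
    subst this
    exact ⟨1, 1, one_ne_zero, by simp⟩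
  | succ n ih =>
    rcases hk.lt_or_eq with h | h
    · obtain ⟨c, ε, he, H⟩ := ih (by omega)
      refine ⟨c * ∏ j ∈ (range (n+1)).erase k, (y j - y (n+1)), ε, he, fun z => ?_⟩
      rw [Finset.prod_range_succ, H z]
      have e1 : (range (n+1+1)).erase k = insert (n+1) ((range (n+1)).erase k) := by
        ext i; simp; omega
      rw [e1, Finset.prod_insert (by simp),
        ← Finset.mul_prod_erase (range (n+1)) _ (show k ∈ range (n+1) by simp; omega)]
      have e2 : ∏ x ∈ (range (n+1)).erase k, (Function.update y k z x - Function.update y k z (n+1))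
          = ∏ j ∈ (range (n+1)).erase k, (y j - y (n+1)) := by
        refine Finset.prod_congr rfl fun j hj => ?_
        rw [Function.update_of_ne (Finset.ne_of_mem_erase hj), Function.update_of_ne (by omega)]
      rw [e2, Function.update_self, Function.update_of_ne (by omega)]
      ring
    · subst h
      refine ⟨∏ i ∈ range (n+1), ∏ j ∈ range i, (y j - y i), (-1)^(n+1), by simp, fun z => ?_⟩
      rw [Finset.prod_range_succ]
      have e1 : (range (n+1+1)).erase (n+1) = range (n+1) := by
        ext i; simp; omega
      rw [e1, mul_assoc]
      congr 1
      · refine Finset.prod_congr rfl fun i hi => Finset.prod_congr rfl fun j hj => ?_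
        simp at hi hj
        rw [Function.update_of_ne (by omega), Function.update_of_ne (by omega)]
      · rw [← Finset.card_range (n+1), ← Finset.prod_const, card_range, ← Finset.prod_mul_distrib]
        refine Finset.prod_congr rfl fun i hi => ?_
        simp at hi
        rw [Function.update_of_ne (by omega), Function.update_self]
        ring

theorem yy_update (f : ℕ → ℕ) (k : ℕ) : yy (upd f k) = Function.update (yy f) k (yy f k + 1) := by
  ext i
  by_cases h : i = k
  · subst h; simp [yy_upd_self]
  · rw [yy_upd_ne f h, Function.update_of_ne h]

theorem ww_HH (n : ℕ) (f : ℕ → ℕ) (hf : Antitone f) (k : ℕ) (hk : k < n) (ha : Addb f k)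
    (hn : f n = 0) : ww n f k * HH n (upd f k) = HH n f := by
  obtain ⟨c, ε, he, H⟩ := vand_split n (yy f) k hk.le
  have v1 := vand_ne n f hf
  have v2 := vand_ne n _ (upd_anti hf ha)
  have F : ∏ i ∈ range (n+1), ((upd f k i + n - i).factorial : ℝ)
      = (yy f k + n + 1) * ∏ i ∈ range (n+1), ((f i + n - i).factorial : ℝ) := by
    have hk' : k ∈ range (n+1) := by simp; omega
    rw [← Finset.mul_prod_erase _ _ hk', ← Finset.mul_prod_erase (range (n+1)) (fun i => ((f i + n - i).factorial : ℝ)) hk', ← mul_assoc]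
    congr 1
    · simp only [upd, Function.update_self]
      rw [show f k + 1 + n - k = (f k + n - k) + 1 by omega, Nat.factorial_succ]
      push_cast
      rw [Nat.cast_sub (by omega)]
      unfold yy
      push_cast; ring
    · refine Finset.prod_congr rfl fun i hi => ?_
      rw [upd, Function.update_of_ne (Finset.ne_of_mem_erase hi)]
  have H1 := H (yy f k)
  rw [Function.update_eq_self] at H1
  have H2 := H (yy f k + 1)
  rw [← yy_update] at H2
  have W : (∏ i ∈ range n, (yy f k - yy f i + 1)) * (yy f k + n + 1) = ∏ i ∈ (range (n+1)).erase k, (yy f k + 1 - yy f i) := by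
    have e1 : ∏ i ∈ range (n+1), (yy f k - yy f i + 1) = ∏ i ∈ (range (n+1)).erase k, (yy f k + 1 - yy f i) := by
      rw [← Finset.mul_prod_erase _ _ (show k ∈ range (n+1) by simp; omega), sub_self, zero_add, one_mul]
      exact Finset.prod_congr rfl fun i hi => by ring
    rw [← e1, Finset.prod_range_succ]
    congr 1
    have : yy f n = - n := by simp [yy, hn]
    rw [this]; ring
  unfold HH ww
  rw [F]
  rw [H1] at v1 ⊢
  rw [H2] at v2 ⊢
  rw [← W] at v2 ⊢
  have n1 := (mul_ne_zero_iff.1 v1.ne')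
  have n2 := (mul_ne_zero_iff.1 v2.ne')
  have n3 := (mul_ne_zero_iff.1 n2.2)
  have n4 := (mul_ne_zero_iff.1 n2.1)
  have n5 := n1.2
  have n6 := n3.1
  have n7 := n3.2
  have n8 := n4.1
  generalize ∏ i ∈ (range (n+1)).erase k, (yy f k - yy f i) = u at *
  generalize ∏ i ∈ range n, (yy f k - yy f i + 1) = v at *
  generalize (yy f k + n + 1) = t at *
  field_simp

/-- downward hook identity -/
theorem down_id (n : ℕ) (g : ℕ → ℕ) (hg : Antitone g) (hgn : g n = 0) :
    ∑ k ∈ (range n).filter (fun k => g (k+1) < g k),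
      (HH n (Function.update g k (g k - 1)))⁻¹ = (∑ i ∈ range n, (g i : ℝ)) * (HH n g)⁻¹ := by
  classical
  have id := hook_id (range (n+1)) (fun i => yy g i + n) (by
    intro i _ j _ h; exact yy_inj hg (by simpa using h))
  simp only [add_sub_add_right_eq_sub, card_range] at id
  have sR : ∑ k ∈ range (n+1), (yy g k + n) - ((n+1 : ℕ):ℝ) * (((n+1:ℕ):ℝ) - 1) / 2 = ∑ i ∈ range n, (g i : ℝ) := by
    have hs : ∀ N : ℕ, ∑ k ∈ range N, (k : ℝ) = N * (N - 1) / 2 := by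
      intro N
      induction N with
      | zero => simp
      | succ N ih => rw [Finset.sum_range_succ, ih]; push_cast; ring
    unfold yy
    rw [Finset.sum_add_distrib, Finset.sum_sub_distrib, hs, Finset.sum_range_succ, hgn]
    simp; ring
  rw [sR] at id
  rw [← id, Finset.sum_mul, Finset.sum_filter, Finset.sum_range_succ]
  have last : yy g n + n = 0 := by simp [yy, hgn]
  rw [last, zero_mul, zero_mul, add_zero]
  refine Finset.sum_congr rfl fun k hk => ?_
  have hk : k < n := by simpa using hk
  split_ifs with hr
  · set f := Function.update g k (g k - 1) with hf
    have hgk : 0 < g k := lt_of_le_of_lt (Nat.zero_le _) hr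
    have hup : upd f k = g := by
      rw [upd, hf, Function.update_self, Function.update_idem, Nat.sub_add_cancel hgk,
        Function.update_eq_self]
    have hfk : f k = g k - 1 := by simp [hf]
    have hfi : ∀ i, i ≠ k → f i = g i := fun i hi => by simp [hf, hi]
    have hfa : Antitone f := by
      intro i j hij
      by_cases h1 : i = k
      · by_cases h2 : j = k
        · rw [h1, h2]
        · rw [h1, hfk, hfi j h2]; have := hg (show k + 1 ≤ j by omega); omega
      · by_cases h2 : j = k
        · rw [h2, hfk, hfi i h1]; have := hg hij; rw [h2] at this; omega
        · rw [hfi i h1, hfi j h2]; exact hg hij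
    have hadd : Addb f k := by
      intro i hi
      rw [hfk, hfi i (by omega)]
      have := hg hi.le
      omega
    have key := ww_HH n f hfa k hk hadd (by rw [hfi n (by omega), hgn])
    rw [hup] at key
    have hpg := HH_pos n g hg
    have hpf := HH_pos n f hfa
    have yk : yy g k = yy f k + 1 := by rw [← hup, yy_upd_self]
    have yi : ∀ i, i ≠ k → yy g i = yy f i := fun i hi => by rw [← hup, yy_upd_ne _ hi]
    have W : (∏ i ∈ range n, (yy f k - yy f i + 1)) * (yy g k + n) = ∏ i ∈ (range (n+1)).erase k, (yy g k - yy g i) := by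
      have e1 : ∏ i ∈ range (n+1), (yy f k - yy f i + 1) = ∏ i ∈ (range (n+1)).erase k, (yy g k - yy g i) := by
        rw [← Finset.mul_prod_erase _ _ (show k ∈ range (n+1) by simp; omega), sub_self, zero_add, one_mul]
        exact Finset.prod_congr rfl fun i hi => by
          rw [yk, yi i (Finset.ne_of_mem_erase hi)]; ring
      rw [← e1, Finset.prod_range_succ]
      congr 1
      have : yy f n = - n := by rw [← yi n (by omega)]; simp [yy, hgn]
      rw [this, yk]; ring
    have W2 : ∏ i ∈ (range (n+1)).erase k, (yy g k - yy g i - 1) = ∏ i ∈ (range (n+1)).erase k, (yy f k - yy f i) :=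
      Finset.prod_congr rfl fun i hi => by
          rw [yk, yi i (Finset.ne_of_mem_erase hi)]; ring
    have hD : ∏ i ∈ (range (n+1)).erase k, (yy g k - yy g i) ≠ 0 :=
      Finset.prod_ne_zero_iff.2 fun i hi => sub_ne_zero.2 fun h => Finset.ne_of_mem_erase hi (yy_inj hg h).symm
    have hD2 : ∏ i ∈ (range (n+1)).erase k, (yy f k - yy f i) ≠ 0 :=
      Finset.prod_ne_zero_iff.2 fun i hi => sub_ne_zero.2 fun h => Finset.ne_of_mem_erase hi (yy_inj hfa h).symm
    rw [W2, ← W, ← key, ww]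
    rw [← W] at hD
    have n1 := mul_ne_zero_iff.1 hD
    have n2 := n1.1
    have n3 := n1.2
    have n4 := hpg.ne'
    generalize ∏ i ∈ (range (n+1)).erase k, (yy f k - yy f i) = u at *
    generalize ∏ i ∈ range n, (yy f k - yy f i + 1) = v at *
    generalize yy g k + n = t at *
    field_simp
  · have h1 : g (k+1) = g k := le_antisymm (hg (by omega)) (not_lt.1 hr)
    rw [Finset.prod_eq_zero (i := k+1) (by simp; omega), zero_div, mul_zero, zero_mul]
    unfold yy
    rw [h1]; push_cast; ring

end part2

section part3
open Finset

section ga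
open Equiv

abbrev GA := MonoidAlgebra ℝ (Perm ℕ)

noncomputable abbrev oo (g : Perm ℕ) : GA := MonoidAlgebra.of ℝ (Perm ℕ) g

def St (m : ℕ) : Subgroup (Perm ℕ) where
  carrier := {g | ∀ i, m ≤ i → g i = i}
  mul_mem' := by
    intro a b ha hb i hi
    rw [Perm.mul_apply, hb i hi, ha i hi]
  one_mem' := fun i _ => rfl
  inv_mem' := by
    intro a ha i hi
    rw [Perm.inv_eq_iff_eq, ha i hi]

theorem mem_St {m : ℕ} {g : Perm ℕ} : g ∈ St m ↔ ∀ i, m ≤ i → g i = i := Iff.rfl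

theorem St_mono {m m' : ℕ} (h : m ≤ m') : St m ≤ St m' := fun _ hg i hi => hg i (h.trans hi)

open Classical in
noncomputable def Ex (m : ℕ) : GA →ₗ[ℝ] GA where
  toFun x := .ofCoeff (x.coeff.filter (· ∈ St m))
  map_add' x y := by
    rw [MonoidAlgebra.coeff_add, Finsupp.filter_add, MonoidAlgebra.ofCoeff_add]
  map_smul' r x := by
    rw [MonoidAlgebra.coeff_smul, Finsupp.filter_smul, MonoidAlgebra.ofCoeff_smul]; rfl

open Classical in
theorem Ex_coeff (m : ℕ) (x : GA) (g : Perm ℕ) :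
    (Ex m x).coeff g = if g ∈ St m then x.coeff g else 0 := by
  change (x.coeff.filter (· ∈ St m)) g = _
  rw [Finsupp.filter_apply]

open Classical in
theorem Ex_oo (m : ℕ) (g : Perm ℕ) : Ex m (oo g) = if g ∈ St m then oo g else 0 := by
  ext h
  rw [Ex_coeff]
  by_cases hgh : g = h
  · subst hgh
    split_ifs <;> rfl
  · have : (oo g).coeff h = 0 := by
      simp [oo, hgh]
    rw [this]
    split_ifs <;> simp [hgh]

noncomputable def Bm (m : ℕ) : Subalgebra ℝ GA := Algebra.adjoin ℝ (oo '' (St m : Set (Perm ℕ)))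

theorem oo_mem {m : ℕ} {g : Perm ℕ} (h : g ∈ St m) : oo g ∈ Bm m :=
  Algebra.subset_adjoin ⟨g, h, rfl⟩

theorem Bm_mono {m m' : ℕ} (h : m ≤ m') : Bm m ≤ Bm m' :=
  Algebra.adjoin_mono (Set.image_mono (St_mono h))

theorem Bm_ind {m : ℕ} {P : GA → Prop} (h0 : P 0) (hs : ∀ g ∈ St m, P (oo g))
    (ha : ∀ x y, P x → P y → P (x + y)) (hm : ∀ (r : ℝ) x, P x → P (r • x)) {x : GA} (hx : x ∈ Bm m) : P x := by
  have h1 : (oo '' (St m : Set (Perm ℕ))) = (((St m).toSubmonoid.map (MonoidAlgebra.of ℝ (Perm ℕ)) : Submonoid GA) : Set GA) := by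
    rfl
  have h2 : x ∈ Submodule.span ℝ (oo '' (St m : Set (Perm ℕ))) := by
    have : x ∈ Subalgebra.toSubmodule (Bm m) := hx
    rw [Bm, Algebra.adjoin_eq_span] at this
    rw [h1, Submonoid.closure_eq] at this
    rwa [h1]
  clear hx
  induction h2 using Submodule.span_induction with
  | mem x h => obtain ⟨g, hg, rfl⟩ := h; exact hs g hg
  | zero => exact h0
  | add x y _ _ h1 h2 => exact ha _ _ h1 h2
  | smul a x _ h => exact hm _ _ h

theorem Ex_mul_left {m : ℕ} {h : GA} (hh : h ∈ Bm m) (x : GA) : Ex m (h * x) = h * Ex m x := by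
  classical
  refine Bm_ind (P := fun h => Ex m (h * x) = h * Ex m x) ?_ ?_ ?_ ?_ hh
  · simp
  · intro g hg
    ext k
    have e : ∀ y : GA, (oo g * y).coeff k = y.coeff (g⁻¹ * k) := by
      intro y
      rw [oo, MonoidAlgebra.of_apply, MonoidAlgebra.coeff_single_mul_apply, one_mul]
    rw [Ex_coeff, e, e, Ex_coeff, (St m).mul_mem_cancel_left ((St m).inv_mem hg)]
  · intro x y h1 h2; rw [add_mul, map_add, h1, h2, add_mul]
  · intro r x h; rw [smul_mul_assoc, map_smul, h, smul_mul_assoc]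

theorem Ex_mul_right {m : ℕ} {h : GA} (hh : h ∈ Bm m) (x : GA) : Ex m (x * h) = Ex m x * h := by
  classical
  refine Bm_ind (P := fun h => Ex m (x * h) = Ex m x * h) ?_ ?_ ?_ ?_ hh
  · simp
  · intro g hg
    ext k
    have e : ∀ y : GA, (y * oo g).coeff k = y.coeff (k * g⁻¹) := by
      intro y
      rw [oo, MonoidAlgebra.of_apply, MonoidAlgebra.coeff_mul_single_apply, mul_one]
    rw [Ex_coeff, e, e, Ex_coeff, (St m).mul_mem_cancel_right ((St m).inv_mem hg)]
  · intro x y h1 h2; rw [mul_add, map_add, h1, h2, mul_add]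
  · intro r x h; rw [mul_smul_comm, map_smul, h, mul_smul_comm]

def tau (x : GA) : ℝ := x.coeff 1

theorem tau_Ex (m : ℕ) (x : GA) : tau (Ex m x) = tau x := by
  classical
  rw [tau, Ex_coeff, if_pos (St m).one_mem, tau]

theorem Ex_one (m : ℕ) : Ex m 1 = 1 := by
  have := Ex_oo m 1
  rw [if_pos (St m).one_mem] at this
  rwa [oo, map_one] at this

theorem Ex_of_mem {m : ℕ} {x : GA} (hx : x ∈ Bm m) : Ex m x = x := by
  have := Ex_mul_right hx 1
  rwa [one_mul, Ex_one, one_mul] at this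

noncomputable def Jm (m : ℕ) : GA := ∑ i ∈ range m, oo (swap i m)

theorem swap_mem {i j m : ℕ} (hi : i < m) (hj : j < m) : swap i j ∈ St m := fun k hk =>
  swap_apply_of_ne_of_ne (by omega) (by omega)

theorem Jm_mem (m : ℕ) : Jm m ∈ Bm (m+1) :=
  sum_mem fun i hi => oo_mem (swap_mem (by have := mem_range.1 hi; omega) (by omega))

theorem Jm_comm (m : ℕ) {x : GA} (hx : x ∈ Bm m) : Commute x (Jm m) := by
  refine Bm_ind (P := fun x => Commute x (Jm m)) ?_ ?_ ?_ ?_ hx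
  · exact Commute.zero_left _
  · intro g hg
    change oo g * Jm m = Jm m * oo g
    rw [Jm, mul_sum, sum_mul]
    have hlt : ∀ g ∈ St m, ∀ i < m, g i < m := by
      intro g hg i hi
      by_contra h
      have := hg (g i) (by omega)
      have := g.injective this
      omega
    refine sum_nbij' (fun i => g i) (fun i => g⁻¹ i) ?_ ?_ ?_ ?_ ?_
    · intro i hi; exact mem_range.2 (hlt g hg i (mem_range.1 hi))
    · intro i hi; exact mem_range.2 (hlt _ ((St m).inv_mem hg) i (mem_range.1 hi))
    · intro i _; simp
    · intro i _; simp
    · intro i _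
      rw [oo, oo, oo, ← map_mul, ← map_mul, mul_swap_eq_swap_mul, hg m le_rfl]
  · intro x y h1 h2; exact h1.add_left h2
  · intro r x h; exact h.smul_left r

theorem Ex_conj (m : ℕ) {y : GA} (hy : y ∈ Bm (m+1)) :
    Ex (m+1) (oo (swap m (m+1)) * y * oo (swap m (m+1))) = Ex m y := by
  classical
  refine Bm_ind (P := fun y => Ex (m+1) (oo (swap m (m+1)) * y * oo (swap m (m+1))) = Ex m y) ?_ ?_ ?_ ?_ hy
  · simp
  · intro g hg
    rw [oo, oo, ← map_mul, ← map_mul]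
    rw [← oo, Ex_oo, ← oo, Ex_oo]
    by_cases h : g ∈ St m
    · have : swap m (m+1) * g * swap m (m+1) = g := by
        rw [mul_assoc, mul_swap_eq_swap_mul, h m le_rfl, h (m+1) (by omega), ← mul_assoc, swap_mul_self, one_mul]
      rw [if_pos h, this, if_pos hg]
    · rw [if_neg h, if_neg]
      intro h2
      apply h
      have h3 := h2 (m+1) le_rfl
      simp only [Perm.mul_apply, swap_apply_right] at h3
      have h4 : g m = m := by
        apply (swap m (m+1)).injective
        rw [h3, swap_apply_left]
      intro i hi
      rcases hi.eq_or_lt with rfl | hi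
      · exact h4
      · exact hg i hi
  · intro x y h1 h2; rw [mul_add, add_mul, map_add, h1, h2, map_add]
  · intro r x h; rw [mul_smul_comm, smul_mul_assoc, map_smul, h, map_smul]

theorem s_sq (m : ℕ) : oo (swap m (m+1)) * oo (swap m (m+1)) = 1 := by
  rw [oo, ← map_mul, swap_mul_self, map_one]

theorem s_J (m : ℕ) : oo (swap m (m+1)) * Jm m = Jm (m+1) * oo (swap m (m+1)) - 1 := by
  rw [Jm, Jm, sum_range_succ, add_mul, s_sq, add_sub_cancel_right, mul_sum, sum_mul]
  refine sum_congr rfl fun i hi => ?_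
  have := mem_range.1 hi
  rw [oo, oo, oo, ← map_mul, ← map_mul, mul_swap_eq_swap_mul, swap_apply_left,
    swap_apply_of_ne_of_ne (by omega) (by omega)]

theorem Ex_s (m : ℕ) : Ex (m+1) (oo (swap m (m+1))) = 0 := by
  classical
  rw [Ex_oo, if_neg]
  intro h
  have := h (m+1) le_rfl
  rw [swap_apply_right] at this
  omega

noncomputable def DD (m : ℕ) : ℕ → GA
  | 0 => 0
  | k+1 => Jm (m+1) ^ k + Jm m * DD m k

theorem DD_comm (m k : ℕ) : Commute (Jm m) (DD m k) := by
  induction k with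
  | zero => exact Commute.zero_right _
  | succ k ih => exact ((Jm_comm (m+1) (Jm_mem m)).pow_right k).add_right ((Commute.refl _).mul_right ih)

theorem s_J_pow (m k : ℕ) : oo (swap m (m+1)) * Jm m ^ k
    = Jm (m+1) ^ k * oo (swap m (m+1)) - DD m k := by
  induction k with
  | zero => simp [DD]
  | succ k ih =>
    rw [pow_succ, ← mul_assoc, ih, sub_mul, mul_assoc, s_J, DD, (DD_comm m k).eq, mul_sub, mul_one, pow_succ,
      mul_assoc]
    abel

theorem moment_step (n m : ℕ) (f : ℕ → ℕ) (hf : Antitone f) (k : ℕ) (hk : k < n) (ha : Addb f k)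
    (e : GA) (h1 : e * Jm m = yy f k • e) (h2 : ∀ p, e * Ex m (Jm m ^ p) = mm n f p • e) (p : ℕ) :
    e * Ex (m+1) (Jm (m+1) ^ p) = mm n (upd f k) p • e := by
  let d : ℕ → ℝ := fun p => p.rec 0 (fun p d => mm n (upd f k) p + yy f k * d)
  let h : ℕ → ℝ := fun p => p.rec 0 (fun p h => d p + yy f k * h)
  have key := mm_step n f hf k hk ha d h rfl rfl (fun _ => rfl) (fun _ => rfl)
  set s := oo (swap m (m+1)) with hs
  have pull : ∀ x, e * Ex (m+1) (Jm m * x) = yy f k • (e * Ex (m+1) x) := by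
    intro x
    rw [Ex_mul_left (Jm_mem m), ← mul_assoc, h1, smul_mul_assoc]
  have Hbs : ∀ p, Ex (m+1) (Jm (m+1) ^ p * s) = Ex (m+1) (DD m p) := by
    intro p
    have : Jm (m+1) ^ p * s = s * Jm m ^ p + DD m p := by rw [hs, s_J_pow]; abel
    rw [this, map_add, Ex_mul_right (pow_mem (Jm_mem m) p), Ex_s, zero_mul, zero_add]
  have main : ∀ p, e * Ex (m+1) (Jm (m+1) ^ p) = mm n (upd f k) p • e ∧
      e * Ex (m+1) (DD m p) = d p • e ∧ e * Ex (m+1) (DD m p * s) = h p • e := by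
    have fin : ∀ p, e * Ex (m+1) (DD m p * s) = h p • e →
        e * Ex (m+1) (Jm (m+1) ^ p) = mm n (upd f k) p • e := by
      intro p hp
      have e1 : s * Jm m ^ p * s = Jm (m+1) ^ p - DD m p * s := by
        rw [hs, s_J_pow, sub_mul, mul_assoc, s_sq, mul_one]
      have e2 := Ex_conj m (pow_mem (Jm_mem m) p)
      rw [← hs, e1, map_sub] at e2
      have e3 : Ex (m+1) (Jm (m+1) ^ p) = Ex m (Jm m ^ p) + Ex (m+1) (DD m p * s) := by
        rw [← e2]; abel
      rw [e3, mul_add, h2, hp, ← add_smul, key p, sub_add_cancel]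
    intro p
    induction p with
    | zero =>
      have hh : e * Ex (m+1) (DD m 0 * s) = h 0 • e := by simp [DD, h]
      exact ⟨fin 0 hh, by simp [DD, d], hh⟩
    | succ p ih =>
      obtain ⟨i1, i2, i3⟩ := ih
      have hh : e * Ex (m+1) (DD m (p+1) * s) = h (p+1) • e := by
        rw [DD, add_mul, map_add, Hbs, mul_assoc, mul_add, pull, i2, i3, smul_smul, ← add_smul]
      refine ⟨fin _ hh, ?_, hh⟩
      rw [DD, map_add, mul_add, i1, pull, i2, smul_smul, ← add_smul]
  exact (main p).1

def Sy (x : GA) : Prop := ∀ g, x.coeff g⁻¹ = x.coeff g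

theorem Sy_one : Sy 1 := by
  classical
  intro g
  simp [MonoidAlgebra.one_def, Finsupp.single_apply, eq_comm]

theorem Sy.add {x y : GA} (hx : Sy x) (hy : Sy y) : Sy (x + y) := fun g => by
  simp [hx g, hy g]

theorem Sy.smul {x : GA} (hx : Sy x) (r : ℝ) : Sy (r • x) := fun g => by
  simp [hx g]

theorem Sy.sum {ι : Type*} (s : Finset ι) (x : ι → GA) (hx : ∀ i ∈ s, Sy (x i)) : Sy (∑ i ∈ s, x i) := by
  classical
  induction s using Finset.induction_on with
  | empty => intro g; simp
  | insert i s hi ih =>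
    rw [sum_insert hi]
    exact (hx i (mem_insert_self _ _)).add (ih fun j hj => hx j (mem_insert_of_mem hj))

theorem Sy.mul {x y : GA} (hx : Sy x) (hy : Sy y) (h : Commute x y) : Sy (x * y) := by
  intro g
  conv_rhs => rw [h.eq]
  rw [MonoidAlgebra.coeff_mul_apply_left, MonoidAlgebra.coeff_mul_apply_right]
  refine sum_nbij' (fun i => i⁻¹) (fun i => i⁻¹) ?_ ?_ ?_ ?_ ?_
  · intro i hi; rw [Finsupp.mem_support_iff] at *; rwa [hx]
  · intro i hi; rw [Finsupp.mem_support_iff] at *; rwa [hx]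
  · intro i _; simp
  · intro i _; simp
  · intro i _
    simp only [inv_inv]
    rw [hx, mul_comm, ← hy (g * i), mul_inv_rev]

theorem Sy_oo_swap (i j : ℕ) : Sy (oo (swap i j)) := by
  classical
  intro g
  simp only [oo, MonoidAlgebra.of_apply, MonoidAlgebra.coeff_single, Finsupp.single_apply]
  congr 1
  rw [← inv_eq_iff_eq_inv, swap_inv]

theorem Sy_Jm (m : ℕ) : Sy (Jm m) := Sy.sum _ _ fun i _ => Sy_oo_swap i m

theorem Sy_aeval (m : ℕ) (P : Polynomial ℝ) : Sy (Polynomial.aeval (Jm m) P) := by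
  have hp : ∀ p, Sy (Jm m ^ p) := by
    intro p
    induction p with
    | zero => rw [pow_zero]; exact Sy_one
    | succ p ih => rw [pow_succ]; exact ih.mul (Sy_Jm m) ((Commute.refl _).pow_left p)
  rw [Polynomial.aeval_eq_sum_range]
  exact Sy.sum _ _ fun i _ => (hp i).smul _

theorem Sy_zero {y : GA} (hy : Sy y) (h : tau (y * y) = 0) : y = 0 := by
  rw [tau, MonoidAlgebra.coeff_mul_apply_left] at h
  ext g
  have h2 : y.coeff.sum (fun a r => r * y.coeff (a⁻¹ * 1)) = ∑ a ∈ y.coeff.support, y.coeff a ^ 2 := by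
    refine sum_congr rfl fun a _ => ?_
    simp only [mul_one]
    rw [hy a, sq]
  rw [h2, sum_eq_zero_iff_of_nonneg (fun _ _ => sq_nonneg _)] at h
  by_cases hg : g ∈ y.coeff.support
  · simpa using h g hg
  · simpa using hg

end ga

end part3

section part4
open Finset

section fam
open Equiv

structure IsSh (m : ℕ) (f : ℕ → ℕ) : Prop where
  anti : Antitone f
  zero : ∀ i, m ≤ i → f i = 0
  sum : ∑ i ∈ range m, f i = m

theorem sh_finite (m : ℕ) : {f | IsSh m f}.Finite := by
  refine Set.Finite.of_injOn (t := (Set.univ : Set (Fin m → Fin (m+1))))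
    (f := fun f i => Fin.ofNat (m+1) (f i)) (fun _ _ => Set.mem_univ _) ?_ Set.finite_univ
  intro f hf g hg h
  have bd : ∀ f, IsSh m f → ∀ i < m, f i < m + 1 := by
    intro f hf i hi
    have := single_le_sum (f := f) (fun _ _ => Nat.zero_le _) (mem_range.2 hi)
    rw [hf.sum] at this
    omega
  funext i
  by_cases hi : i < m
  · have := congrArg Fin.val (congrFun h ⟨i, hi⟩)
    simp only [Fin.ofNat] at this
    rwa [Nat.mod_eq_of_lt (bd f hf i hi), Nat.mod_eq_of_lt (bd g hg i hi)] at this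
  · rw [hf.zero i (by omega), hg.zero i (by omega)]

noncomputable def Shs (m : ℕ) : Finset (ℕ → ℕ) := (sh_finite m).toFinset

theorem mem_Shs {m : ℕ} {f : ℕ → ℕ} : f ∈ Shs m ↔ IsSh m f := by simp [Shs]

def dn (f : ℕ → ℕ) (k : ℕ) : ℕ → ℕ := Function.update f k (f k - 1)

theorem IsSh.lt {m : ℕ} {f : ℕ → ℕ} (hf : IsSh m f) {k : ℕ} (ha : Addb f k) : k ≤ m := by
  by_contra h
  have := ha m (by omega)
  rw [hf.zero m le_rfl] at this
  omega

theorem sum_update_aux (f : ℕ → ℕ) (N k v : ℕ) (hk : k < N) :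
    ∑ i ∈ range N, Function.update f k v i + f k = ∑ i ∈ range N, f i + v := by
  rw [sum_update_of_mem (mem_range.2 hk), ← Finset.add_sum_erase (range N) f (mem_range.2 hk), sdiff_singleton_eq_erase]
  omega

theorem IsSh.sum_succ {m : ℕ} {f : ℕ → ℕ} (hf : IsSh m f) : ∑ i ∈ range (m+1), f i = m := by
  rw [sum_range_succ, hf.sum, hf.zero m le_rfl, add_zero]

theorem IsSh.up {m : ℕ} {f : ℕ → ℕ} (hf : IsSh m f) {k : ℕ} (ha : Addb f k) : IsSh (m+1) (upd f k) where
  anti := upd_anti hf.anti ha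
  zero i hi := by
    have := hf.lt ha
    rw [upd, Function.update_of_ne (by omega), hf.zero i (by omega)]
  sum := by
    have := hf.lt ha
    have h := sum_update_aux f (m+1) k (f k + 1) (by omega)
    rw [hf.sum_succ] at h
    rw [upd]; omega

theorem IsSh.up_rem {m : ℕ} {f : ℕ → ℕ} (hf : IsSh m f) (k : ℕ) : upd f k (k+1) < upd f k k := by
  rw [upd, Function.update_self, Function.update_of_ne (by omega)]
  have := hf.anti (show k ≤ k+1 by omega)
  omega

theorem dn_upd (f : ℕ → ℕ) (k : ℕ) : dn (upd f k) k = f := by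
  rw [dn, upd, Function.update_self, Function.update_idem, Nat.add_sub_cancel, Function.update_eq_self]

theorem upd_dn {f : ℕ → ℕ} {k : ℕ} (h : f (k+1) < f k) : upd (dn f k) k = f := by
  rw [dn, upd, Function.update_self, Function.update_idem, Nat.sub_add_cancel (by omega), Function.update_eq_self]

theorem dn_add {m : ℕ} {f : ℕ → ℕ} (hf : IsSh m f) {k : ℕ} (h : f (k+1) < f k) : Addb (dn f k) k := by
  intro i hi
  rw [dn, Function.update_self, Function.update_of_ne (by omega)]
  have := hf.anti hi.le
  omega

theorem rem_lt {m : ℕ} {f : ℕ → ℕ} (hf : IsSh m f) {k : ℕ} (h : f (k+1) < f k) : k < m := by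
  by_contra h2
  have := hf.zero k (by omega)
  omega

theorem IsSh.down {m : ℕ} {f : ℕ → ℕ} (hf : IsSh (m+1) f) {k : ℕ} (h : f (k+1) < f k) : IsSh m (dn f k) := by
  have hk := rem_lt hf h
  have hs := sum_update_aux f (m+1) k (f k - 1) hk
  rw [hf.sum] at hs
  have hs' : ∑ i ∈ range (m+1), dn f k i = m := by rw [dn]; omega
  have an : Antitone (dn f k) := by
    intro i j hij
    unfold dn
    by_cases h1 : i = k
    · subst h1
      by_cases h2 : j = i
      · subst h2; simp
      · rw [Function.update_self, Function.update_of_ne h2]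
        have := hf.anti (show i + 1 ≤ j by omega); omega
    · rw [Function.update_of_ne h1]
      have := hf.anti hij
      by_cases h2 : j = k
      · subst h2; rw [Function.update_self]; omega
      · rwa [Function.update_of_ne h2]
  have hm : dn f k m = 0 := by
    by_contra h3
    have : ∑ i ∈ range (m+1), 1 ≤ ∑ i ∈ range (m+1), dn f k i := sum_le_sum fun i hi => by
      have := an (show i ≤ m by have := mem_range.1 hi; omega)
      omega
    rw [hs'] at this
    simp at this
  refine ⟨an, fun i hi => ?_, ?_⟩
  · have := an hi; omega
  · rw [sum_range_succ, hm] at hs'; omega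

noncomputable def eps (n : ℕ) (q : ℝ) (f : ℕ → ℕ) : ℝ := ∏ i ∈ range n, ∏ b ∈ range (f i), (q + (b:ℝ) - (i:ℝ))

theorem eps_upd (n : ℕ) (q : ℝ) (f : ℕ → ℕ) (k : ℕ) (hk : k < n) : eps n q (upd f k) = eps n q f * (q + yy f k) := by
  have hk' := mem_range.2 hk
  rw [eps, eps, ← mul_prod_erase _ _ hk', ← mul_prod_erase (range n) (fun i => ∏ b ∈ range (f i), (q + (b:ℝ) - (i:ℝ))) hk']
  have : ∏ i ∈ (range n).erase k, ∏ b ∈ range (upd f k i), (q + (b:ℝ) - (i:ℝ)) = ∏ i ∈ (range n).erase k, ∏ b ∈ range (f i), (q + (b:ℝ) - (i:ℝ)) :=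
    prod_congr rfl fun i hi => by rw [upd, Function.update_of_ne (ne_of_mem_erase hi)]
  rw [this, upd, Function.update_self, prod_range_succ, yy]
  ring

noncomputable def En (q : ℝ) : ℕ → GA
  | 0 => 1
  | m+1 => En q m * (q • 1 + Jm m)

theorem En_mem (q : ℝ) (m : ℕ) : En q m ∈ Bm m := by
  induction m with
  | zero => exact one_mem _
  | succ m ih => exact mul_mem (Bm_mono (Nat.le_succ m) ih) (add_mem (Subalgebra.smul_mem _ (one_mem _) _) (Jm_mem m))

structure Fam (n m : ℕ) (e : (ℕ → ℕ) → GA) : Prop where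
  mem : ∀ f, IsSh m f → e f ∈ Bm m
  sy : ∀ f, IsSh m f → Sy (e f)
  idem : ∀ f, IsSh m f → e f * e f = e f
  orth : ∀ f g, IsSh m f → IsSh m g → f ≠ g → e f * e g = 0
  sum : ∑ f ∈ Shs m, e f = 1
  ev : ∀ f, IsSh m f → ∀ q, En q m * e f = eps n q f • e f
  mom : ∀ f, IsSh m f → ∀ p, e f * Ex m (Jm m ^ p) = mm n f p • e f
  tr : ∀ f, IsSh m f → tau (e f) = (m.factorial : ℝ) / HH n f ^ 2

theorem HH_zero (n : ℕ) : HH n (fun _ => 0) = 1 := by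
  rw [HH, div_eq_one_iff_eq (vand_ne n _ (fun _ _ _ => le_rfl)).ne', ← prod_range_reflect]
  refine prod_congr rfl fun i hi => ?_
  have hi := mem_range.1 hi
  have e1 : 0 + n - (n + 1 - 1 - i) = i := by omega
  rw [e1]
  clear hi e1
  rw [← prod_range_reflect, ← prod_range_add_one_eq_factorial]
  push_cast
  refine prod_congr rfl fun j hj => ?_
  have hj := mem_range.1 hj
  have e2 : i - 1 - j = i - (j + 1) := by omega
  rw [yy, yy, e2, Nat.cast_sub (by omega)]
  push_cast; ring

theorem isSh_zero {f : ℕ → ℕ} (hf : IsSh 0 f) : f = fun _ => 0 := funext fun i => hf.zero i (Nat.zero_le _)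

theorem fam_zero (n : ℕ) : Fam n 0 (fun _ => 1) where
  mem _ _ := one_mem _
  sy _ _ := Sy_one
  idem _ _ := one_mul _
  orth f g hf hg h := absurd ((isSh_zero hf).trans (isSh_zero hg).symm) h
  sum := by
    have : Shs 0 = {fun _ => 0} := by
      ext f
      rw [mem_Shs, mem_singleton]
      exact ⟨isSh_zero, fun h => by subst h; exact ⟨fun _ _ _ => le_rfl, fun _ _ => rfl, rfl⟩⟩
    rw [this, sum_singleton]
  ev f hf q := by rw [isSh_zero hf]; simp [En, eps]
  mom f hf p := by
    rw [isSh_zero hf, one_mul]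
    have h := congrArg (PowerSeries.coeff p) (MM_zero n)
    rw [MM, PowerSeries.coeff_mk, PowerSeries.coeff_one] at h
    rw [h]
    have : Jm 0 = 0 := by simp [Jm]
    rw [this]
    split_ifs with hp
    · subst hp; rw [pow_zero, Ex_one, one_smul]
    · rw [zero_pow hp, map_zero, zero_smul]
  tr f hf := by
    rw [isSh_zero hf, HH_zero]
    simp [tau]

open Classical in
noncomputable def ad (n : ℕ) (f : ℕ → ℕ) : Finset ℕ := (range n).filter (Addb f)

open Classical in
theorem mem_ad {n m : ℕ} {f : ℕ → ℕ} (hmn : m < n) (hf : IsSh m f) {k : ℕ} : k ∈ ad n f ↔ Addb f k := by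
  rw [ad, mem_filter, mem_range]
  exact ⟨fun h => h.2, fun h => ⟨by have := hf.lt h; omega, h⟩⟩

open Classical in
theorem mm_ad {n m : ℕ} {f : ℕ → ℕ} (hmn : m < n) (hf : IsSh m f) (p : ℕ) :
    mm n f p = ∑ k ∈ ad n f, ww n f k * yy f k ^ p := by
  rw [mm]
  symm
  refine sum_subset ?_ ?_
  · intro k hk
    have := mem_range.1 (mem_filter.1 hk).1
    exact mem_range.2 (by omega)
  · intro k hk h
    rw [mem_ad hmn hf] at h
    rw [ww_not_add n f hf.anti k (by have := mem_range.1 hk; omega) h, zero_mul]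

theorem tau_aeval {n m : ℕ} {e : (ℕ → ℕ) → GA} (F : Fam n m e) {f : ℕ → ℕ} (hmn : m < n) (hf : IsSh m f)
    (P : Polynomial ℝ) : tau (e f * Polynomial.aeval (Jm m) P) = (∑ k ∈ ad n f, ww n f k * P.eval (yy f k)) * tau (e f) := by
  rw [← tau_Ex m, Ex_mul_left (F.mem f hf), Polynomial.aeval_eq_sum_range, map_sum, mul_sum]
  have : ∀ i, e f * Ex m (P.coeff i • Jm m ^ i) = (P.coeff i * mm n f i) • e f := by
    intro i
    rw [map_smul, mul_smul_comm, F.mom f hf, smul_smul]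
  simp only [this]
  rw [← sum_smul]
  have t : ∀ r : ℝ, tau (r • e f) = r * tau (e f) := fun r => by simp [tau]
  rw [t]
  congr 1
  simp only [mm_ad hmn hf, mul_sum, Polynomial.eval_eq_sum_range]
  rw [sum_comm]
  exact sum_congr rfl fun k _ => sum_congr rfl fun i _ => by ring

theorem aeval_comm {m : ℕ} {x : GA} (hx : x ∈ Bm m) (P : Polynomial ℝ) : Commute x (Polynomial.aeval (Jm m) P) := by
  rw [Polynomial.aeval_eq_sum_range]
  exact Commute.sum_right _ _ _ fun i _ => ((Jm_comm m hx).pow_right i).smul_right _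

theorem aeval_van {n m : ℕ} {e : (ℕ → ℕ) → GA} (F : Fam n m e) {f : ℕ → ℕ} (hmn : m < n) (hf : IsSh m f)
    (P : Polynomial ℝ) (hP : ∀ k ∈ ad n f, P.eval (yy f k) = 0) : Polynomial.aeval (Jm m) P * e f = 0 := by
  have hc := aeval_comm (F.mem f hf) P
  apply Sy_zero ((Sy_aeval m P).mul (F.sy f hf) hc.symm)
  have : Polynomial.aeval (Jm m) P * e f * (Polynomial.aeval (Jm m) P * e f) = e f * Polynomial.aeval (Jm m) (P * P) := by
    rw [map_mul]
    calc _ = Polynomial.aeval (Jm m) P * (e f * Polynomial.aeval (Jm m) P) * e f := by simp only [mul_assoc]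
      _ = Polynomial.aeval (Jm m) P * (Polynomial.aeval (Jm m) P * e f) * e f := by rw [hc.eq]
      _ = Polynomial.aeval (Jm m) P * (Polynomial.aeval (Jm m) P * (e f * e f)) := by simp only [mul_assoc]
      _ = Polynomial.aeval (Jm m) P * (e f * Polynomial.aeval (Jm m) P) := by rw [F.idem f hf, hc.eq]
      _ = (Polynomial.aeval (Jm m) P * e f) * Polynomial.aeval (Jm m) P := by simp only [mul_assoc]
      _ = (e f * Polynomial.aeval (Jm m) P) * Polynomial.aeval (Jm m) P := by rw [hc.eq]
      _ = _ := by simp only [mul_assoc]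
  rw [this, tau_aeval F hmn hf, sum_eq_zero, zero_mul]
  intro k hk
  rw [Polynomial.eval_mul, hP k hk, zero_mul, mul_zero]

noncomputable def uu (n m : ℕ) (e : (ℕ → ℕ) → GA) (f : ℕ → ℕ) (k : ℕ) : GA :=
  Polynomial.aeval (Jm m) (Lagrange.basis (ad n f) (yy f) k) * e f

theorem lb_eval {n : ℕ} {f : ℕ → ℕ} (hf : Antitone f) {k l : ℕ} (hk : k ∈ ad n f) (hl : l ∈ ad n f) :
    (Lagrange.basis (ad n f) (yy f) k).eval (yy f l) = if k = l then 1 else 0 := by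
  split_ifs with h
  · subst h; exact Lagrange.eval_basis_self ((yy_inj hf).injOn) hk
  · exact Lagrange.eval_basis_of_ne h hl

open Classical in
theorem uu_mul {n m : ℕ} {e : (ℕ → ℕ) → GA} (F : Fam n m e) (hmn : m < n) {f g : ℕ → ℕ} (hf : IsSh m f) (hg : IsSh m g)
    {k l : ℕ} (hk : Addb f k) (hl : Addb g l) : uu n m e f k * uu n m e g l = if f = g ∧ k = l then uu n m e f k else 0 := by
  have e1 : uu n m e f k * uu n m e g l = Polynomial.aeval (Jm m) (Lagrange.basis (ad n f) (yy f) k * Lagrange.basis (ad n g) (yy g) l) * (e f * e g) := by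
    rw [uu, uu, mul_assoc, ← mul_assoc (e f), (aeval_comm (F.mem f hf) _).eq, map_mul]
    simp only [mul_assoc]
  rw [e1]
  by_cases hfg : f = g
  · subst hfg
    rw [F.idem f hf]
    have hk' := (mem_ad hmn hf).2 hk
    have hl' := (mem_ad hmn hf).2 hl
    by_cases hkl : k = l
    · subst hkl
      rw [if_pos ⟨rfl, rfl⟩, uu, ← sub_eq_zero, ← sub_mul, ← map_sub]
      apply aeval_van F hmn hf
      intro j hj
      rw [Polynomial.eval_sub, Polynomial.eval_mul, lb_eval hf.anti hk' hj]
      split_ifs <;> simp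
    · rw [if_neg (fun h => hkl h.2)]
      apply aeval_van F hmn hf
      intro j hj
      rw [Polynomial.eval_mul, lb_eval hf.anti hk' hj, lb_eval hf.anti hl' hj]
      split_ifs with h1 h2
      · exact absurd (h1.trans h2.symm) hkl
      all_goals simp
  · rw [F.orth f g hf hg hfg, mul_zero, if_neg (fun h => hfg h.1)]

theorem ad_ne {n m : ℕ} {f : ℕ → ℕ} (hmn : m < n) (hf : IsSh m f) : (ad n f).Nonempty :=
  ⟨0, (mem_ad hmn hf).2 fun i hi => absurd hi (Nat.not_lt_zero _)⟩

theorem uu_sum {n m : ℕ} {e : (ℕ → ℕ) → GA} {f : ℕ → ℕ} (hmn : m < n) (hf : IsSh m f) :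
    ∑ k ∈ ad n f, uu n m e f k = e f := by
  simp only [uu]
  rw [← sum_mul, ← map_sum, Lagrange.sum_basis (yy_inj hf.anti).injOn (ad_ne hmn hf), map_one, one_mul]

theorem uu_J {n m : ℕ} {e : (ℕ → ℕ) → GA} (F : Fam n m e) (hmn : m < n) {f : ℕ → ℕ} (hf : IsSh m f)
    {k : ℕ} (hk : Addb f k) : Jm m * uu n m e f k = yy f k • uu n m e f k := by
  have h := aeval_van F hmn hf ((Polynomial.X - Polynomial.C (yy f k)) * Lagrange.basis (ad n f) (yy f) k) (by
    intro j hj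
    rw [Polynomial.eval_mul, lb_eval hf.anti ((mem_ad hmn hf).2 hk) hj]
    split_ifs with h
    · subst h; simp
    · simp)
  rw [map_mul, map_sub, Polynomial.aeval_X, Polynomial.aeval_C, sub_mul, sub_mul, sub_eq_zero, mul_assoc, mul_assoc, ← uu,
    ← Algebra.smul_def] at h
  exact h

theorem uu_mem {n m : ℕ} {e : (ℕ → ℕ) → GA} (F : Fam n m e) {f : ℕ → ℕ} (hf : IsSh m f)
    (k : ℕ) : uu n m e f k ∈ Bm (m+1) := by
  refine mul_mem ?_ (Bm_mono (Nat.le_succ m) (F.mem f hf))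
  rw [Polynomial.aeval_eq_sum_range]
  exact sum_mem fun i _ => Subalgebra.smul_mem _ (pow_mem (Jm_mem m) i) _

theorem uu_sy {n m : ℕ} {e : (ℕ → ℕ) → GA} (F : Fam n m e) {f : ℕ → ℕ} (hf : IsSh m f)
    (k : ℕ) : Sy (uu n m e f k) :=
  (Sy_aeval m _).mul (F.sy f hf) (aeval_comm (F.mem f hf) _).symm

theorem uu_J' {n m : ℕ} {e : (ℕ → ℕ) → GA} (F : Fam n m e) (hmn : m < n) {f : ℕ → ℕ} (hf : IsSh m f)
    {k : ℕ} (hk : Addb f k) : uu n m e f k * Jm m = yy f k • uu n m e f k := by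
  rw [← uu_J F hmn hf hk]
  have h1 : Commute (Jm m) (uu n m e f k) := by
    refine Commute.mul_right ?_ (Jm_comm m (F.mem f hf)).symm
    rw [Polynomial.aeval_eq_sum_range]
    exact Commute.sum_right _ _ _ fun i _ => ((Commute.refl _).pow_right i).smul_right _
  exact h1.eq.symm

theorem uu_ev {n m : ℕ} {e : (ℕ → ℕ) → GA} (F : Fam n m e) (hmn : m < n) {f : ℕ → ℕ} (hf : IsSh m f)
    {k : ℕ} (hk : Addb f k) (q : ℝ) : En q (m+1) * uu n m e f k = eps n q (upd f k) • uu n m e f k := by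
  have hkn : k < n := lt_of_le_of_lt (hf.lt hk) hmn
  rw [En, mul_assoc, add_mul, smul_mul_assoc, one_mul, uu_J F hmn hf hk, ← add_smul, mul_smul_comm]
  have : En q m * uu n m e f k = eps n q f • uu n m e f k := by
    rw [uu, ← mul_assoc, (aeval_comm (En_mem q m) _).eq, mul_assoc, F.ev f hf, mul_smul_comm]
  rw [this, smul_smul, eps_upd n q f k hkn, mul_comm]

theorem uu_mom {n m : ℕ} {e : (ℕ → ℕ) → GA} (F : Fam n m e) (hmn : m < n) {f : ℕ → ℕ} (hf : IsSh m f)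
    {k : ℕ} (hk : Addb f k) (p : ℕ) : uu n m e f k * Ex (m+1) (Jm (m+1) ^ p) = mm n (upd f k) p • uu n m e f k := by
  have hkn : k < n := lt_of_le_of_lt (hf.lt hk) hmn
  refine moment_step n m f hf.anti k hkn hk _ (uu_J' F hmn hf hk) (fun p => ?_) p
  rw [uu, mul_assoc, F.mom f hf, mul_smul_comm]

theorem uu_tr {n m : ℕ} {e : (ℕ → ℕ) → GA} (F : Fam n m e) (hmn : m < n) {f : ℕ → ℕ} (hf : IsSh m f)
    {k : ℕ} (hk : Addb f k) : tau (uu n m e f k) = (m.factorial : ℝ) / HH n (upd f k) * (HH n f)⁻¹ := by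
  have hkn : k < n := lt_of_le_of_lt (hf.lt hk) hmn
  have hk' := (mem_ad hmn hf).2 hk
  rw [uu, ← (aeval_comm (F.mem f hf) _).eq, tau_aeval F hmn hf, F.tr f hf]
  rw [sum_eq_single_of_mem k hk' (fun j hj hjk => by rw [lb_eval hf.anti hk' hj, if_neg hjk.symm, mul_zero]),
    lb_eval hf.anti hk' hk', if_pos rfl, mul_one]
  have h := ww_HH n f hf.anti k hkn hk (hf.zero n hmn.le)
  have p1 := (HH_pos n f hf.anti).ne'
  have p2 := (HH_pos n _ (hf.up hk).anti).ne'
  have : ww n f k = HH n f / HH n (upd f k) := by rw [← h]; field_simp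
  rw [this]
  field_simp

def rm (n : ℕ) (g : ℕ → ℕ) : Finset ℕ := (range n).filter (fun k => g (k+1) < g k)

theorem mem_rm {n m : ℕ} {f : ℕ → ℕ} (hmn : m < n) (hf : IsSh (m+1) f) {k : ℕ} : k ∈ rm n f ↔ f (k+1) < f k := by
  rw [rm, mem_filter, mem_range]
  exact ⟨fun h => h.2, fun h => ⟨by have := rem_lt hf h; omega, h⟩⟩

theorem fam_step {n m : ℕ} {e : (ℕ → ℕ) → GA} (F : Fam n m e) (hmn : m < n) :
    Fam n (m+1) (fun g => ∑ k ∈ rm n g, uu n m e (dn g k) k) where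
  mem g hg := sum_mem fun k hk => uu_mem F (hg.down ((mem_rm hmn hg).1 hk)) k
  sy g hg := Sy.sum _ _ fun k hk => uu_sy F (hg.down ((mem_rm hmn hg).1 hk)) k
  idem g hg := by
    rw [sum_mul_sum]
    refine sum_congr rfl fun k hk => ?_
    have hk' := (mem_rm hmn hg).1 hk
    rw [sum_eq_single_of_mem k hk]
    · rw [uu_mul F hmn (hg.down hk') (hg.down hk') (dn_add hg hk') (dn_add hg hk'), if_pos ⟨rfl, rfl⟩]
    · intro l hl hlk
      have hl' := (mem_rm hmn hg).1 hl
      rw [uu_mul F hmn (hg.down hk') (hg.down hl') (dn_add hg hk') (dn_add hg hl'), if_neg (fun h => hlk h.2.symm)]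
  orth f g hf hg hfg := by
    rw [sum_mul_sum]
    refine sum_eq_zero fun k hk => sum_eq_zero fun l hl => ?_
    have hk' := (mem_rm hmn hf).1 hk
    have hl' := (mem_rm hmn hg).1 hl
    rw [uu_mul F hmn (hf.down hk') (hg.down hl') (dn_add hf hk') (dn_add hg hl'), if_neg]
    rintro ⟨h1, rfl⟩
    apply hfg
    rw [← upd_dn hk', h1, upd_dn hl']
  sum := by
    rw [← F.sum, ← sum_congr rfl fun f hf => uu_sum (e := e) hmn (mem_Shs.1 hf), sum_sigma', sum_sigma']
    refine sum_nbij' (fun p => ⟨dn p.1 p.2, p.2⟩) (fun p => ⟨upd p.1 p.2, p.2⟩) ?_ ?_ ?_ ?_ ?_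
    · rintro ⟨g, k⟩ h
      simp only [mem_sigma, mem_Shs] at h ⊢
      have hk := (mem_rm hmn h.1).1 h.2
      exact ⟨h.1.down hk, (mem_ad hmn (h.1.down hk)).2 (dn_add h.1 hk)⟩
    · rintro ⟨g, k⟩ h
      simp only [mem_sigma, mem_Shs] at h ⊢
      have hk := (mem_ad hmn h.1).1 h.2
      exact ⟨h.1.up hk, (mem_rm hmn (h.1.up hk)).2 (h.1.up_rem k)⟩
    · rintro ⟨g, k⟩ h
      simp only [mem_sigma, mem_Shs] at h ⊢
      rw [upd_dn ((mem_rm hmn h.1).1 h.2)]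
    · rintro ⟨g, k⟩ h
      simp only [dn_upd]
    · rintro ⟨g, k⟩ h
      rfl
  ev g hg q := by
    rw [mul_sum, smul_sum]
    refine sum_congr rfl fun k hk => ?_
    have hk' := (mem_rm hmn hg).1 hk
    rw [uu_ev F hmn (hg.down hk') (dn_add hg hk'), upd_dn hk']
  mom g hg p := by
    rw [sum_mul, smul_sum]
    refine sum_congr rfl fun k hk => ?_
    have hk' := (mem_rm hmn hg).1 hk
    rw [uu_mom F hmn (hg.down hk') (dn_add hg hk'), upd_dn hk']
  tr g hg := by
    have t : ∀ (s : Finset ℕ) (x : ℕ → GA), tau (∑ k ∈ s, x k) = ∑ k ∈ s, tau (x k) := by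
      intro s x
      simp [tau]
    rw [t]
    have : ∀ k ∈ rm n g, tau (uu n m e (dn g k) k) = (m.factorial : ℝ) / HH n g * (HH n (dn g k))⁻¹ := by
      intro k hk
      have hk' := (mem_rm hmn hg).1 hk
      rw [uu_tr F hmn (hg.down hk') (dn_add hg hk'), upd_dn hk']
    rw [sum_congr rfl this, ← mul_sum]
    have d := down_id n g hg.anti (hg.zero n hmn)
    have d' : ∑ k ∈ rm n g, (HH n (dn g k))⁻¹ = (∑ i ∈ range n, (g i : ℝ)) * (HH n g)⁻¹ := d
    have s : ∑ i ∈ range n, g i = m + 1 := by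
      rw [← hg.sum]
      symm
      refine sum_subset (range_mono hmn) fun i _ hi => hg.zero i (by simpa using hi)
    rw [d', ← Nat.cast_sum, s, Nat.factorial_succ]
    push_cast
    have := (HH_pos n g hg.anti).ne'
    field_simp

theorem fam_exists (n : ℕ) : ∀ m ≤ n, ∃ e, Fam n m e := by
  intro m
  induction m with
  | zero => intro _; exact ⟨_, fam_zero n⟩
  | succ m ih =>
    intro h
    obtain ⟨e, F⟩ := ih (by omega)
    exact ⟨_, fam_step F h⟩

end fam

end part4

section part5
open Finset

section tr
open Equiv

theorem nc_add {n : ℕ} (g : Perm (Fin n)) : numCycles g + g.cycleType.sum = n + Multiset.card g.cycleType := by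
  rw [numCycles, Perm.sum_cycleType]
  have h := Finset.card_filter_add_card_filter_not (s := (univ : Finset (Fin n))) (fun i => g i = i)
  have h2 : g.support = univ.filter (fun i => ¬ g i = i) := by ext; simp
  rw [h2]
  simp only [card_univ, Fintype.card_fin] at h
  omega

theorem nc_swap {n : ℕ} (g : Perm (Fin n)) (x : Fin n) (hx : g x ≠ x) :
    numCycles (swap x (g x) * g) = numCycles g + 1 := by
  set c := g.cycleOf x with hc
  have hmem : c ∈ g.cycleFactorsFinset := Perm.cycleOf_mem_cycleFactorsFinset_iff.2 (Perm.mem_support.2 hx)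
  have hcyc : c.IsCycle := Perm.isCycle_cycleOf g hx
  have hcx : c x = g x := Perm.cycleOf_apply_self g x
  set r := g * c⁻¹ with hr
  have hd : Perm.Disjoint r c := Perm.disjoint_mul_inv_of_mem_cycleFactorsFinset hmem
  have hg : g = c * r := by rw [← hd.commute.eq, hr, inv_mul_cancel_right]
  have h1 := nc_add g
  have h2 := nc_add (swap x (g x) * g)
  have ctg : g.cycleType = c.cycleType + r.cycleType := by
    conv_lhs => rw [hg]
    exact hd.symm.cycleType_mul
  rw [hcyc.cycleType] at ctg
  have hcx' : c x ≠ x := by rwa [hcx]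
  have hnew : swap x (g x) * g = (swap x (c x) * c) * r := by
    conv_lhs => rw [← hcx, hg]
    rw [mul_assoc]
  by_cases hcc : c (c x) = x
  · have hsw := hcyc.eq_swap_of_apply_apply_eq_self hcx' hcc
    have e1 : swap x (c x) * c = 1 := by
      conv_lhs => rw [hsw]
      simp
    rw [e1, one_mul] at hnew
    have e2 : #c.support = 2 := by rw [hsw]; exact Perm.card_support_swap hcx'.symm
    rw [hnew] at h2 ⊢
    rw [ctg, e2] at h1
    simp at h1
    omega
  · have hcy' := hcyc.swap_mul hcx' hcc
    have hsup := Perm.support_swap_mul_eq c x hcc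
    have hd' : Perm.Disjoint (swap x (c x) * c) r := by
      rw [Perm.disjoint_iff_disjoint_support, hsup]
      exact (Perm.disjoint_iff_disjoint_support.1 hd.symm).mono_left sdiff_subset
    have ctn : (swap x (g x) * g).cycleType = (swap x (c x) * c).cycleType + r.cycleType := by
      rw [hnew, hd'.cycleType_mul]
    rw [hcy'.cycleType, hsup, sdiff_singleton_eq_erase, card_erase_of_mem (Perm.mem_support.2 hcx')] at ctn
    have : 0 < #c.support := card_pos.2 ⟨x, Perm.mem_support.2 hcx'⟩
    rw [ctg] at h1
    rw [ctn] at h2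
    simp at h1 h2
    omega

theorem nc_lift {n : ℕ} (e : Perm (Fin n)) : numCycles (Perm.decomposeFin.symm (0, e)) = numCycles e + 1 := by
  have h : Perm.decomposeFin.symm (0, e) = e.extendDomain (finSuccAboveEquiv (0 : Fin (n+1))) := by
    ext x
    congr 1
    induction x using Fin.cases with
    | zero =>
      rw [Perm.extendDomain_apply_not_subtype _ _ (by simp)]
      simp
    | succ x =>
      have := Perm.extendDomain_apply_image e (finSuccAboveEquiv (0 : Fin (n+1))) x
      simp only [finSuccAboveEquiv_apply, Fin.succAbove_zero] at this
      rw [this]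
      simp
  have ct : (Perm.decomposeFin.symm (0, e)).cycleType = e.cycleType := by
    rw [h]
    convert Perm.cycleType_extendDomain (finSuccAboveEquiv (0 : Fin (n+1)))
  have h1 := nc_add e
  have h2 := nc_add (Perm.decomposeFin.symm (0, e))
  rw [ct] at h2
  omega

theorem dec_mul {n : ℕ} (p : Fin (n+1)) (e : Perm (Fin n)) :
    Perm.decomposeFin.symm (p, e) = swap 0 p * Perm.decomposeFin.symm (0, e) := by
  ext x
  congr 1
  induction x using Fin.cases with
  | zero => simp
  | succ x => simp

theorem nc_dec {n : ℕ} (p : Fin n) (e : Perm (Fin n)) :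
    numCycles (Perm.decomposeFin.symm (p.succ, e)) = numCycles e := by
  have h := nc_swap (Perm.decomposeFin.symm (p.succ, e)) 0 (by simp)
  rw [Perm.decomposeFin_symm_apply_zero, dec_mul, ← mul_assoc, swap_mul_self, one_mul, nc_lift, ← dec_mul] at h
  omega

def io (m : ℕ) : Fin m ↪ ℕ := ⟨fun i => m - 1 - i, fun i j h => by
  have := i.2
  have := j.2
  simp only at h
  ext
  omega⟩

theorem io_apply (m : ℕ) (i : Fin m) : io m i = m - 1 - i := rfl

noncomputable def ph (m : ℕ) : Perm (Fin m) →* Perm ℕ := Perm.viaEmbeddingHom (io m)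

theorem ph_apply {m : ℕ} (g : Perm (Fin m)) (i : Fin m) : ph m g (io m i) = io m (g i) :=
  Perm.viaEmbedding_apply g (io m) i

theorem ph_ge {m : ℕ} (g : Perm (Fin m)) (i : ℕ) (h : m ≤ i) : ph m g i = i := by
  refine Perm.viaEmbedding_apply_of_notMem g (io m) i ?_
  rintro ⟨j, hj⟩
  have := j.2
  rw [io_apply] at hj
  omega

theorem io_surj {m i : ℕ} (h : i < m) : ∃ j, io m j = i := ⟨⟨m - 1 - i, by omega⟩, by rw [io_apply]; simp only; omega⟩

theorem ph_dec {m : ℕ} (p : Fin (m+1)) (e : Perm (Fin m)) :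
    ph (m+1) (Perm.decomposeFin.symm (p, e)) = swap m (io (m+1) p) * ph m e := by
  have io0 : io (m+1) 0 = m := by rw [io_apply]; simp
  ext x
  rw [Perm.mul_apply]
  rcases lt_trichotomy x m with h | h | h
  · obtain ⟨j, rfl⟩ := io_surj h
    have hj : ∀ j : Fin m, io m j = io (m+1) j.succ := by
      intro j
      rw [io_apply, io_apply, Fin.val_succ]; omega
    rw [ph_apply, hj, hj, ph_apply, Perm.decomposeFin_symm_apply_succ]
    rw [(io (m+1)).injective.map_swap, io0]
  · subst h
    have h := ph_apply (Perm.decomposeFin.symm (p, e)) 0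
    rw [io0] at h
    rw [h, Perm.decomposeFin_symm_apply_zero, ph_ge e x le_rfl, swap_apply_left]
  · rw [ph_ge _ _ h, ph_ge _ _ h.le, swap_apply_of_ne_of_ne (by omega)]
    rw [io_apply]; omega

theorem ph_surj {m : ℕ} {g : Perm ℕ} (hg : g ∈ St m) : ∃ π, ph m π = g := by
  have hlt : ∀ g ∈ St m, ∀ i < m, g i < m := by
    intro g hg i hi
    by_contra h
    have := hg (g i) (by omega)
    have := g.injective this
    omega
  have hlt' := hlt _ ((St m).inv_mem hg)
  have H := hlt g hg
  let π : Perm (Fin m) :=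
    { toFun := fun i => ⟨m - 1 - g (io m i), by have := i.2; omega⟩
      invFun := fun i => ⟨m - 1 - g⁻¹ (io m i), by have := i.2; omega⟩
      left_inv := by
        intro i
        ext
        have h1 : io m i < m := by rw [io_apply]; have := i.2; omega
        have h2 := H _ h1
        simp only [io_apply] at *
        have h3 : m - 1 - (m - 1 - g (m - 1 - i)) = g (m - 1 - i) := by omega
        have h4 : g⁻¹ (g (m - 1 - i)) = m - 1 - i := g.symm_apply_apply _
        rw [h3, h4]
        have := i.2; omega
      right_inv := by
        intro i
        ext
        have h1 : io m i < m := by rw [io_apply]; have := i.2; omega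
        have h2 := hlt' _ h1
        simp only [io_apply] at *
        have h3 : m - 1 - (m - 1 - g⁻¹ (m - 1 - i)) = g⁻¹ (m - 1 - i) := by omega
        have h4 : g (g⁻¹ (m - 1 - i)) = m - 1 - i := g.apply_symm_apply _
        rw [h3, h4]
        have := i.2; omega }
  refine ⟨π, ?_⟩
  ext x
  by_cases h : x < m
  · obtain ⟨j, rfl⟩ := io_surj h
    rw [ph_apply]
    change m - 1 - (m - 1 - g (io m j)) = _
    have := H _ h
    omega
  · rw [ph_ge _ _ (by omega), hg x (by omega)]

theorem En_eq (q : ℝ) (m : ℕ) : ∑ π : Perm (Fin m), q ^ numCycles π • oo (ph m π) = En q m := by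
  induction m with
  | zero =>
    have : (univ : Finset (Perm (Fin 0))) = {1} := by
      ext g; simp only [mem_univ, mem_singleton, true_iff]; exact Subsingleton.elim _ _
    rw [this, sum_singleton, map_one, En, oo, map_one]
    simp [numCycles]
  | succ m ih =>
    rw [← Perm.decomposeFin.symm.sum_comp, Fintype.sum_prod_type, En, (?_ : En q m * (q • 1 + Jm m) = (q • 1 + Jm m) * En q m), ← ih,
      Fin.sum_univ_succ]
    · rw [add_mul]
      congr 1
      · rw [mul_sum]
        refine sum_congr rfl fun e _ => ?_
        rw [nc_lift, ph_dec]
        have : io (m+1) 0 = m := by rw [io_apply]; simp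
        rw [this, swap_self, smul_mul_assoc, one_mul, smul_smul, pow_succ, mul_comm]
        rfl
      · have hJ : Jm m = ∑ p : Fin m, oo (swap m (io (m+1) p.succ)) := by
          rw [Jm, ← sum_range_reflect, Finset.sum_range]
          refine sum_congr rfl fun p _ => ?_
          rw [swap_comm, io_apply, Fin.val_succ]
          congr 2
          omega
        rw [hJ, sum_mul]
        refine sum_congr rfl fun p _ => ?_
        rw [mul_sum]
        refine sum_congr rfl fun e _ => ?_
        rw [nc_dec, ph_dec, oo, map_mul, mul_smul_comm]
    · refine Commute.eq (Commute.add_right ?_ (Jm_comm m (En_mem q m)))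
      exact (Commute.one_right _).smul_right q

noncomputable def Tq {n : ℕ} (q : ℝ) : MonoidAlgebra ℝ (Perm (Fin n)) :=
  ∑ π : Perm (Fin n), q ^ numCycles π • MonoidAlgebra.of ℝ _ π

theorem fin_fam (n : ℕ) : ∃ e : (ℕ → ℕ) → MonoidAlgebra ℝ (Perm (Fin n)),
    (∀ f, IsSh n f → e f * e f = e f) ∧
    (∀ f g, IsSh n f → IsSh n g → f ≠ g → e f * e g = 0) ∧
    (∑ f ∈ Shs n, e f = 1) ∧
    (∀ f, IsSh n f → ∀ q, Tq q * e f = eps n q f • e f) ∧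
    (∀ f, IsSh n f → (e f).coeff 1 = (n.factorial : ℝ) / HH n f ^ 2) := by
  obtain ⟨e, F⟩ := fam_exists n n le_rfl
  let Φ := MonoidAlgebra.mapDomainAlgHom ℝ ℝ (ph n)
  have hinj : Function.Injective (ph n) := Perm.viaEmbeddingHom_injective (io n)
  have Φinj : Function.Injective Φ := MonoidAlgebra.mapDomain_injective hinj
  have Φof : ∀ π, Φ (MonoidAlgebra.of ℝ _ π) = oo (ph n π) := by
    intro π
    simp [Φ, oo, MonoidAlgebra.mapDomainAlgHom]
  have surj : ∀ x ∈ Bm n, ∃ y, Φ y = x := by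
    intro x hx
    refine Bm_ind (P := fun x => ∃ y, Φ y = x) ⟨0, map_zero _⟩ ?_ ?_ ?_ hx
    · intro g hg
      obtain ⟨π, rfl⟩ := ph_surj hg
      exact ⟨_, Φof π⟩
    · rintro x y ⟨a, rfl⟩ ⟨b, rfl⟩
      exact ⟨a + b, map_add _ _ _⟩
    · rintro r x ⟨a, rfl⟩
      exact ⟨r • a, map_smul _ _ _⟩
  have : ∀ f, ∃ y, IsSh n f → Φ y = e f := by
    intro f
    by_cases hf : IsSh n f
    · obtain ⟨y, hy⟩ := surj _ (F.mem f hf)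
      exact ⟨y, fun _ => hy⟩
    · exact ⟨0, fun h => absurd h hf⟩
  choose e' he' using this
  refine ⟨e', ?_, ?_, ?_, ?_, ?_⟩
  · intro f hf
    apply Φinj
    rw [map_mul, he' f hf, F.idem f hf]
  · intro f g hf hg h
    apply Φinj
    rw [map_mul, he' f hf, he' g hg, F.orth f g hf hg h, map_zero]
  · apply Φinj
    rw [map_sum, map_one, ← F.sum]
    exact sum_congr rfl fun f hf => he' f (mem_Shs.1 hf)
  · intro f hf q
    apply Φinj
    rw [map_mul, map_smul, he' f hf, ← F.ev f hf, ← En_eq, Tq, map_sum]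
    simp only [map_smul, Φof]
  · intro f hf
    rw [← F.tr f hf, ← he' f hf, tau]
    have h1 : (Φ (e' f)).coeff (ph n 1) = (e' f).coeff 1 := Finsupp.mapDomain_apply hinj _ _
    rw [← h1, map_one]

end tr

end part5

section part6
open Finset

section gp
set_option linter.unusedSectionVars false
open MonoidAlgebra

variable {G : Type} [Group G] [Fintype G]

theorem of_mul_coeff (g h : G) (y : MonoidAlgebra ℝ G) : (of ℝ G g * y).coeff h = y.coeff (g⁻¹ * h) := by
  rw [of_apply, coeff_single_mul_apply, one_mul]

theorem mul_of_coeff (g h : G) (y : MonoidAlgebra ℝ G) : (y * of ℝ G g).coeff h = y.coeff (h * g⁻¹) := by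
  rw [of_apply, coeff_mul_single_apply, mul_one]

theorem sum_of (x : MonoidAlgebra ℝ G) : ∑ g : G, x.coeff g • of ℝ G g = x := by
  conv_rhs => rw [← sum_coeff_single x]
  rw [Finsupp.sum_fintype _ _ (by simp)]
  refine sum_congr rfl fun g _ => ?_
  rw [of_apply, smul_single, smul_eq_mul, mul_one]

theorem cen_of {z : MonoidAlgebra ℝ G} (h : ∀ g, of ℝ G g * z = z * of ℝ G g) (x : MonoidAlgebra ℝ G) : x * z = z * x := by
  induction x using MonoidAlgebra.induction_on with
  | of m => exact h m
  | add x y hx hy => rw [add_mul, mul_add, hx, hy]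
  | smul r x hx => rw [smul_mul_assoc, mul_smul_comm, hx]

theorem cen_coeff {z : MonoidAlgebra ℝ G} (h : ∀ x, x * z = z * x) (a b : G) (hab : IsConj a b) : z.coeff a = z.coeff b := by
  obtain ⟨c, rfl⟩ := isConj_iff.1 hab
  have := congrArg (fun t => t.coeff (c * a)) (h (of ℝ G c))
  simp only [of_mul_coeff, mul_of_coeff] at this
  rw [← this]
  congr 1
  group

theorem cen_scalar {ι : Type} (S : Finset ι) (e : ι → MonoidAlgebra ℝ G)
    (idem : ∀ i ∈ S, e i * e i = e i) (orth : ∀ i ∈ S, ∀ j ∈ S, i ≠ j → e i * e j = 0)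
    (cen : ∀ i ∈ S, ∀ x, x * e i = e i * x) (hc : Nat.card (ConjClasses G) ≤ #S)
    (ne : ∀ i ∈ S, e i ≠ 0) (z : MonoidAlgebra ℝ G) (hz : ∀ x, x * z = z * x) (i : ι) (hi : i ∈ S) :
    ∃ c : ℝ, z * e i = c • e i := by
  classical
  let Z : Submodule ℝ (MonoidAlgebra ℝ G) :=
    { carrier := {z | ∀ x, x * z = z * x}
      add_mem' := fun {a b} ha hb x => by rw [mul_add, add_mul, ha x, hb x]
      zero_mem' := fun x => by rw [mul_zero, zero_mul]
      smul_mem' := fun r a ha x => by rw [mul_smul_comm, smul_mul_assoc, ha x] }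
  let F : Z →ₗ[ℝ] (ConjClasses G → ℝ) :=
    { toFun := fun z c => z.1.coeff (Quotient.out c)
      map_add' := fun a b => by ext c; rfl
      map_smul' := fun a b => by ext c; rfl }
  have Finj : Function.Injective F := by
    intro a b hab
    ext g
    have h := congrFun hab (ConjClasses.mk g)
    have hcj : IsConj (Quotient.out (ConjClasses.mk g)) g := Quotient.exact (Quotient.out_eq (ConjClasses.mk g))
    change a.1.coeff _ = b.1.coeff _ at h
    rw [cen_coeff a.2 _ _ hcj, cen_coeff b.2 _ _ hcj] at h
    exact h
  have : Finite (ConjClasses G) := Quotient.finite _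
  letI : Fintype (ConjClasses G) := Fintype.ofFinite _
  have : FiniteDimensional ℝ Z := FiniteDimensional.of_injective F Finj
  have hle : Module.finrank ℝ Z ≤ #S := by
    refine le_trans (LinearMap.finrank_le_finrank_of_injective Finj) ?_
    rwa [Module.finrank_fintype_fun_eq_card, ← Nat.card_eq_fintype_card]
  let b : S → Z := fun i => ⟨e i, cen i i.2⟩
  have li : LinearIndependent ℝ b := by
    rw [Fintype.linearIndependent_iff]
    intro g hg i
    have h1 : ∑ j : S, g j • e j = 0 := by
      have := congrArg (Submodule.subtype Z) hg
      simpa [b] using this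
    have h2 := congrArg (· * e i) h1
    simp only [sum_mul, zero_mul, smul_mul_assoc] at h2
    rw [sum_eq_single i, idem i i.2] at h2
    · exact (smul_eq_zero.1 h2).resolve_right (ne i i.2)
    · intro j _ hj
      rw [orth j j.2 i i.2 (fun h => hj (Subtype.ext h)), smul_zero]
    · simp
  have hcard : Fintype.card S = Module.finrank ℝ Z :=
    le_antisymm li.fintype_card_le_finrank (by simpa using hle)
  have hsp := li.span_eq_top_of_card_eq_finrank' hcard
  have hzm : (⟨z, hz⟩ : Z) ∈ Submodule.span ℝ (Set.range b) := by rw [hsp]; trivial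
  obtain ⟨c, hcz⟩ := (Submodule.mem_span_range_iff_exists_fun ℝ).1 hzm
  have h1 : ∑ j : S, c j • e j = z := by
    have := congrArg (Submodule.subtype Z) hcz
    simpa [b] using this
  refine ⟨c ⟨i, hi⟩, ?_⟩
  rw [← h1]
  simp only [sum_mul, smul_mul_assoc]
  rw [sum_eq_single ⟨i, hi⟩, idem i hi]
  · intro j _ hj
    rw [orth j j.2 i hi (fun h => hj (Subtype.ext h)), smul_zero]
  · simp

noncomputable def Av (x : MonoidAlgebra ℝ G) : MonoidAlgebra ℝ G := ∑ a : G, of ℝ G a⁻¹ * x * of ℝ G a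

theorem Av_cen (x y : MonoidAlgebra ℝ G) : y * Av x = Av x * y := by
  refine cen_of (fun g => ?_) y
  rw [Av, mul_sum, sum_mul, ← Equiv.sum_comp (Equiv.mulRight g)]
  refine sum_congr rfl fun a _ => ?_
  simp only [Equiv.coe_mulRight, mul_inv_rev, map_mul, ← mul_assoc]
  rw [← map_mul, mul_inv_cancel, map_one, one_mul]

theorem Av_tau (x : MonoidAlgebra ℝ G) : (Av x).coeff 1 = Fintype.card G * x.coeff 1 := by
  rw [Av, coeff_sum, Finsupp.finsetSum_apply]
  simp only [mul_of_coeff, of_mul_coeff]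
  simp

theorem Av_mul (x e : MonoidAlgebra ℝ G) (h : ∀ y, y * e = e * y) : Av x * e = Av (x * e) := by
  rw [Av, Av, sum_mul]
  refine sum_congr rfl fun a _ => ?_
  rw [mul_assoc, h (of ℝ G a), ← mul_assoc, mul_assoc (of ℝ G a⁻¹)]

noncomputable def KK : MonoidAlgebra ℝ G := ∑ c : G, of ℝ G c * Av (of ℝ G c⁻¹)

theorem KK_mul (e : MonoidAlgebra ℝ G) (h : ∀ y, y * e = e * y) (he : e * e = e) (h0 : e.coeff 1 ≠ 0)
    (hs : ∀ z : MonoidAlgebra ℝ G, (∀ x, x * z = z * x) → ∃ c : ℝ, z * e = c • e) :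
    KK * e = ((Fintype.card G : ℝ) / e.coeff 1) • e := by
  have h1 : ∀ x : MonoidAlgebra ℝ G, Av x * e = ((Fintype.card G : ℝ) / e.coeff 1 * (x * e).coeff 1) • e := by
    intro x
    obtain ⟨c, hc⟩ := hs (Av x) (fun y => Av_cen x y)
    have h2 := congrArg (fun t => t.coeff 1) hc
    beta_reduce at h2
    rw [Av_mul x e h, Av_tau, coeff_smul_apply, smul_eq_mul] at h2
    rw [hc]
    congr 1
    field_simp
    rw [h2]
  rw [KK, sum_mul]
  have : ∀ c : G, of ℝ G c * Av (of ℝ G c⁻¹) * e = ((Fintype.card G : ℝ) / e.coeff 1) • ((e.coeff c • of ℝ G c) * e) := by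
    intro c
    rw [mul_assoc, h1, of_mul_coeff, mul_smul_comm, smul_mul_assoc, smul_smul]
    simp
  simp only [this]
  rw [← smul_sum, ← sum_mul, sum_of, he]

def wg {k : ℕ} (v : Fin k → G) : G := (List.ofFn v).prod * (List.ofFn fun i => (v i)⁻¹).prod

noncomputable def Wk (k : ℕ) : MonoidAlgebra ℝ G := ∑ v : Fin k → G, of ℝ G (wg v)

theorem sumFcons {M : Type} [AddCommMonoid M] (k : ℕ) (F : (Fin (k+1) → G) → M) :
    ∑ v, F v = ∑ a : G, ∑ v : Fin k → G, F (Fin.cons a v) := by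
  rw [← Equiv.sum_comp (Fin.consEquiv (fun _ => G)), Fintype.sum_prod_type]
  rfl

theorem Wk_succ (k : ℕ) : Wk (k+2) = KK * (Wk k : MonoidAlgebra ℝ G) := by
  rw [Wk, sumFcons]
  simp only [sumFcons (k := k)]
  rw [Wk, mul_sum]
  have h1 : ∀ a : G, ∑ b : G, ∑ v : Fin k → G, of ℝ G (wg (Fin.cons a (Fin.cons b v : Fin (k+1) → G) : Fin (k+2) → G))
      = ∑ v : Fin k → G, ∑ c : G, of ℝ G (c * (List.ofFn v).prod * a⁻¹ * c⁻¹ * a * (List.ofFn fun i => (v i)⁻¹).prod) := by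
    intro a
    rw [sum_comm]
    refine sum_congr rfl fun v _ => ?_
    rw [← Equiv.sum_comp (Equiv.mulLeft a⁻¹)]
    refine sum_congr rfl fun c _ => ?_
    congr 1
    rw [wg]
    simp [List.ofFn_succ, mul_assoc]
  simp only [h1]
  rw [sum_comm]
  refine sum_congr rfl fun v _ => ?_
  rw [sum_comm, KK, sum_mul, wg, map_mul]
  refine sum_congr rfl fun c _ => ?_
  simp only [map_mul]
  have := Av_cen (of ℝ G c⁻¹) (of ℝ G (List.ofFn v).prod)
  rw [mul_assoc (of ℝ G c), ← mul_assoc (Av _), ← this, Av, mul_sum, sum_mul, mul_sum]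
  refine sum_congr rfl fun a _ => ?_
  simp only [mul_assoc]

theorem Wk_mul (e : MonoidAlgebra ℝ G) (c : ℝ) (h : KK * e = c • e) (m : ℕ) :
    Wk (2 * m + 1) * e = (Fintype.card G * c ^ m) • e := by
  induction m with
  | zero =>
    have : (Wk (2*0+1) : MonoidAlgebra ℝ G) = (Fintype.card G : ℝ) • 1 := by
      rw [Wk, sumFcons]
      simp [wg, List.ofFn_succ, one_def, Nat.cast_smul_eq_nsmul]
    rw [this]; simp
  | succ m ih =>
    rw [show 2 * (m+1) + 1 = (2*m+1) + 2 by ring, Wk_succ, mul_assoc, ih, mul_smul_comm, h, smul_smul]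
    congr 1
    ring

end gp

end part6

section part7
open Finset

section fin
open MonoidAlgebra Equiv

def cls (n : ℕ) (f : ℕ → ℕ) : Finset (Σ _ : ℕ, ℕ) := (range n).sigma fun i => range (f i)

theorem mem_cls {n : ℕ} {f : ℕ → ℕ} (c : Σ _ : ℕ, ℕ) : c ∈ cls n f ↔ c.1 < n ∧ c.2 < f c.1 := by
  simp [cls]

theorem exists_lt {n : ℕ} {f g : ℕ → ℕ} (hf : IsSh n f) (hg : IsSh n g) (h : f ≠ g) : ∃ i, f i < g i := by
  by_contra! H
  apply h
  have := (Finset.sum_eq_sum_iff_of_le (s := range n) (f := g) (g := f) (fun i _ => H i)).1 (by rw [hf.sum, hg.sum])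
  ext i
  by_cases hi : i < n
  · exact (this i (mem_range.2 hi)).symm
  · rw [hf.zero i (by omega), hg.zero i (by omega)]

theorem eps_inj {n : ℕ} {f g : ℕ → ℕ} (hf : IsSh n f) (hg : IsSh n g) (h : ∀ q, eps n q f = eps n q g) : f = g := by
  classical
  by_contra hne
  obtain ⟨i, hi⟩ := exists_lt hf hg hne
  let ct : (Σ _ : ℕ, ℕ) → ℝ := fun c => (c.1 : ℝ) - c.2
  let M : (ℕ → ℕ) → Multiset ℝ := fun f => (cls n f).val.map ct
  have hev : ∀ f q, (((M f).map fun a => Polynomial.X - Polynomial.C a).prod).eval q = eps n q f := by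
    intro f q
    rw [eps, ← prod_sigma (range n) (fun i => range (f i)) (fun c => q + (c.2 : ℝ) - c.1), Multiset.map_map]
    change (∏ c ∈ cls n f, (Polynomial.X - Polynomial.C (ct c))).eval q = _
    rw [Polynomial.eval_prod]
    refine prod_congr rfl fun c _ => ?_
    simp [ct]; ring
  have hP : ((M f).map fun a => Polynomial.X - Polynomial.C a).prod = ((M g).map fun a => Polynomial.X - Polynomial.C a).prod := by
    apply Polynomial.funext
    intro q
    rw [hev, hev, h]
  have hM : M f = M g := by
    rw [← Polynomial.roots_multiset_prod_X_sub_C (M f), hP, Polynomial.roots_multiset_prod_X_sub_C]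
  have hcnt := congrArg (Multiset.count ((i : ℝ) - f i)) hM
  simp only [M, Multiset.count_map] at hcnt
  change #((cls n f).filter fun c => (i : ℝ) - f i = ct c) = #((cls n g).filter fun c => (i : ℝ) - f i = ct c) at hcnt
  have hss : (cls n f).filter (fun c => (i : ℝ) - f i = ct c) ⊂ (cls n g).filter fun c => (i : ℝ) - f i = ct c := by
    rw [Finset.ssubset_iff_of_subset]
    · refine ⟨⟨i, f i⟩, ?_, ?_⟩
      · rw [mem_filter, mem_cls]
        refine ⟨⟨?_, hi⟩, rfl⟩
        by_contra hin
        rw [hg.zero i (by simpa using hin)] at hi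
        omega
      · rw [mem_filter, mem_cls]
        simp
    · rintro ⟨j, b⟩ hc
      rw [mem_filter, mem_cls] at hc ⊢
      obtain ⟨⟨h1, h2⟩, h3⟩ := hc
      refine ⟨⟨h1, ?_⟩, h3⟩
      simp only [ct] at h1 h2 h3 ⊢
      have h4 : i + b = j + f i := by
        have : (i : ℝ) + b = j + f i := by linarith
        exact_mod_cast this
      have h5 : j < i := by
        by_contra hj
        have := hf.anti (show i ≤ j by omega)
        omega
      have := hg.anti h5.le
      omega
  exact absurd hcnt (card_lt_card hss).ne

theorem nc_conj {n : ℕ} (g π : Perm (Fin n)) : numCycles (g * π * g⁻¹) = numCycles π := by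
  have h1 := nc_add (g * π * g⁻¹)
  have h2 := nc_add π
  rw [Perm.cycleType_conj] at h1
  omega

theorem nc_inv {n : ℕ} (π : Perm (Fin n)) : numCycles π⁻¹ = numCycles π := by
  have h1 := nc_add π⁻¹
  have h2 := nc_add π
  rw [Perm.cycleType_inv] at h1
  omega

theorem Tq_coeff {n : ℕ} (q : ℝ) (g : Perm (Fin n)) : (Tq q).coeff g = q ^ numCycles g := by
  rw [Tq, coeff_sum, Finsupp.finsetSum_apply, sum_eq_single g]
  · simp
  · intro b _ hb
    simp [hb]
  · simp

theorem Tq_cen {n : ℕ} (q : ℝ) (x : MonoidAlgebra ℝ (Perm (Fin n))) : x * Tq q = Tq q * x := by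
  refine cen_of (fun g => ?_) x
  ext h
  rw [of_mul_coeff, mul_of_coeff, Tq_coeff, Tq_coeff, ← nc_conj g (g⁻¹ * h)]
  simp

theorem card_cls (n : ℕ) : Nat.card (ConjClasses (Perm (Fin n))) ≤ Fintype.card (Nat.Partition n) := by
  have h : Fintype.card (Nat.Partition n) = Nat.card (Nat.Partition (Fintype.card (Fin n))) := by
    rw [Fintype.card_fin, Nat.card_eq_fintype_card]
  rw [h]
  let F : ConjClasses (Perm (Fin n)) → Nat.Partition (Fintype.card (Fin n)) :=
    Quotient.lift Perm.partition (fun a b hab => Perm.partition_eq_of_isConj.1 hab)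
  refine Nat.card_le_card_of_injective F ?_
  intro a b
  induction a using Quotient.inductionOn with | _ a =>
  induction b using Quotient.inductionOn with | _ b =>
  intro h
  exact Quotient.sound (Perm.partition_eq_of_isConj.2 h)

theorem perm_main (n : ℕ) (hcard : Fintype.card (Nat.Partition n) ≤ #(Shs n)) (m : ℕ) (q : ℝ) :
    ∑ v : Fin (2 * (m + 1) + 1) → Perm (Fin n), q ^ numCycles (wc v) =
      (n.factorial : ℝ) ^ 2 * ∑ f ∈ Shs n, HH n f ^ (2 * m) * eps n q f := by
  obtain ⟨e, idem, orth, sm, ev, tr⟩ := fin_fam n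
  have hHH : ∀ f, IsSh n f → 0 < HH n f := fun f hf => HH_pos n f hf.anti
  have hfac : (0 : ℝ) < n.factorial := by exact_mod_cast n.factorial_pos
  have tr0 : ∀ f, IsSh n f → (e f).coeff 1 ≠ 0 := by
    intro f hf
    rw [tr f hf]
    have := hHH f hf
    positivity
  have hz : ∀ f g, IsSh n f → IsSh n g → f ≠ g → ∀ x, e f * x * e g = 0 := by
    intro f g hf hg hfg x
    have : ∃ q, eps n q f ≠ eps n q g := by
      by_contra! H
      exact hfg (eps_inj hf hg H)
    obtain ⟨q, hq⟩ := this
    have h1 : Tq q * (e f * x * e g) = eps n q f • (e f * x * e g) := by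
      rw [← mul_assoc, ← mul_assoc, ev f hf, smul_mul_assoc, smul_mul_assoc]
    have h2 : Tq q * (e f * x * e g) = eps n q g • (e f * x * e g) := by
      rw [← mul_assoc, ← Tq_cen, mul_assoc, ev g hg, mul_smul_comm]
    rw [h1, ← sub_eq_zero, ← sub_smul] at h2
    exact (smul_eq_zero.1 h2).resolve_left (sub_ne_zero.2 hq)
  have cen : ∀ f, IsSh n f → ∀ x, x * e f = e f * x := by
    intro f hf x
    have h1 : e f * x = e f * x * e f := by
      conv_lhs => rw [← mul_one (e f * x), ← sm, mul_sum]
      rw [sum_eq_single f]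
      · intro g hg hgf
        exact hz f g hf (mem_Shs.1 hg) hgf.symm x
      · intro h
        exact absurd (mem_Shs.2 hf) h
    have h2 : x * e f = e f * x * e f := by
      conv_lhs => rw [← one_mul (x * e f), ← sm, sum_mul]
      rw [sum_eq_single f, mul_assoc]
      · intro g hg hgf
        rw [← mul_assoc]
        exact hz g f (mem_Shs.1 hg) hf hgf x
      · intro h
        exact absurd (mem_Shs.2 hf) h
    rw [h1, h2]
  have hsc := cen_scalar (Shs n) e (fun f hf => idem f (mem_Shs.1 hf))
    (fun f hf g hg => orth f g (mem_Shs.1 hf) (mem_Shs.1 hg))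
    (fun f hf => cen f (mem_Shs.1 hf)) ((card_cls n).trans hcard)
    (fun f hf h => tr0 f (mem_Shs.1 hf) (by rw [h]; rfl))
  have hK : ∀ f, IsSh n f → KK * e f = (HH n f ^ 2) • e f := by
    intro f hf
    rw [KK_mul (e f) (cen f hf) (idem f hf) (tr0 f hf) (fun z hz => hsc z hz f (mem_Shs.2 hf)), tr f hf,
      Fintype.card_perm, Fintype.card_fin]
    congr 1
    have := hHH f hf
    field_simp
  have hL : ∑ v : Fin (2 * (m + 1) + 1) → Perm (Fin n), q ^ numCycles (wc v) = ((Tq q : MonoidAlgebra ℝ (Perm (Fin n))) * Wk (2 * (m + 1) + 1)).coeff 1 := by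
    rw [Wk, mul_sum, coeff_sum, Finsupp.finsetSum_apply]
    refine sum_congr rfl fun v _ => ?_
    rw [mul_of_coeff, one_mul, Tq_coeff, nc_inv]
    rfl
  rw [hL, ← mul_one (Tq q * _), ← sm, mul_sum, coeff_sum, Finsupp.finsetSum_apply, mul_sum]
  refine sum_congr rfl fun f hf => ?_
  have hf := mem_Shs.1 hf
  rw [mul_assoc, Wk_mul (e f) _ (hK f hf), mul_smul_comm, ev f hf, coeff_smul_apply, coeff_smul_apply, tr f hf,
    Fintype.card_perm, Fintype.card_fin, smul_eq_mul, smul_eq_mul]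
  have := hHH f hf
  field_simp
  ring

end fin

end part7

section part8
open Finset

section part

theorem tele (a R c : ℕ) (h : c ≤ a) :
    (∏ b ∈ range c, (a - b + (R + 1))) * (a - c + R + 1) = (a + R + 1) * ∏ b ∈ range c, (a - b + R) := by
  have h1 : (∏ b ∈ range c, (a - b + (R + 1))) * (a - c + R + 1) = ∏ b ∈ range (c + 1), (a - b + (R + 1)) := by
    rw [prod_range_succ]; rfl
  rw [h1, prod_range_succ', mul_comm]
  congr 1
  refine prod_congr rfl fun b hb => ?_
  have := mem_range.1 hb
  omega

theorem row (a : ℕ) (g : ℕ → ℕ) (hg : Antitone g) (h0 : g 0 ≤ a) (R : ℕ) :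
    (∏ b ∈ range a, (a - b + #((range R).filter fun j => b < g j))) * ∏ j ∈ range R, (a - g j + j + 1) =
      (a + R).factorial := by
  induction R with
  | zero =>
    simp only [range_zero, filter_empty, card_empty, add_zero, prod_empty, mul_one]
    rw [← prod_range_add_one_eq_factorial, ← prod_range_reflect]
    refine prod_congr rfl fun b hb => ?_
    have := mem_range.1 hb
    omega
  | succ R ih =>
    have hR : g R ≤ a := (hg (Nat.zero_le R)).trans h0
    have hsplit : ∀ F : ℕ → ℕ, ∏ b ∈ range a, F b = (∏ b ∈ range (g R), F b) * ∏ b ∈ Ico (g R) a, F b := by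
      intro F
      rw [range_eq_Ico, range_eq_Ico, prod_Ico_consecutive _ (Nat.zero_le _) hR]
    have cnt : ∀ R', R' ≤ R + 1 → ∀ b < g R, #((range R').filter fun j => b < g j) = R' := by
      intro R' hR' b hb
      rw [filter_true_of_mem, card_range]
      intro j hj
      have := mem_range.1 hj
      exact hb.trans_le (hg (by omega))
    have c1 : ∏ b ∈ range (g R), (a - b + #((range (R+1)).filter fun j => b < g j)) = ∏ b ∈ range (g R), (a - b + (R + 1)) :=
      prod_congr rfl fun b hb => by rw [cnt (R+1) le_rfl b (mem_range.1 hb)]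
    have c0 : ∏ b ∈ range (g R), (a - b + #((range R).filter fun j => b < g j)) = ∏ b ∈ range (g R), (a - b + R) :=
      prod_congr rfl fun b hb => by rw [cnt R (by omega) b (mem_range.1 hb)]
    have c2 : ∏ b ∈ Ico (g R) a, (a - b + #((range (R+1)).filter fun j => b < g j)) =
        ∏ b ∈ Ico (g R) a, (a - b + #((range R).filter fun j => b < g j)) := by
      refine prod_congr rfl fun b hb => ?_
      have := (mem_Ico.1 hb).1
      rw [range_add_one, filter_insert, if_neg (by omega)]
    rw [hsplit, c0] at ih
    rw [hsplit, c1, c2, prod_range_succ, ← add_assoc, Nat.factorial_succ, ← ih]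
    have t := tele a R (g R) hR
    calc _ = ((∏ b ∈ range (g R), (a - b + (R + 1))) * (a - g R + R + 1)) *
          ((∏ b ∈ Ico (g R) a, (a - b + #((range R).filter fun j => b < g j))) * ∏ j ∈ range R, (a - g j + j + 1)) := by ring
      _ = _ := by rw [t]; ring

theorem hook_eq (n : ℕ) (f : ℕ → ℕ) (hf : Antitone f) :
    ((∏ a ∈ range (n+1), ∏ b ∈ range (f a), (f a + #((range (n+1)).filter fun a' => b < f a') - a - b - 1) : ℕ) : ℝ) = HH n f := by
  have hden : ∏ i ∈ range (n+1), ∏ j ∈ range i, (yy f j - yy f i) =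
      ((∏ i ∈ range (n+1), ∏ t ∈ range (n - i), (f i - f (i + 1 + t) + t + 1) : ℕ) : ℝ) := by
    rw [prod_comm' (s' := fun j => Ico (j+1) (n+1)) (t' := range (n+1))]
    · push_cast
      refine prod_congr rfl fun j hj => ?_
      rw [prod_Ico_eq_prod_range, show n + 1 - (j + 1) = n - j by omega]
      refine prod_congr rfl fun t _ => ?_
      have : f (j + 1 + t) ≤ f j := hf (by omega)
      rw [Nat.cast_sub this, yy, yy]
      push_cast
      ring
    · intro x y
      simp only [mem_range, mem_Ico]
      omega
  have hnum : (∏ i ∈ range (n+1), ((f i + n - i).factorial : ℝ)) =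
      ((∏ a ∈ range (n+1), ∏ b ∈ range (f a), (f a + #((range (n+1)).filter fun a' => b < f a') - a - b - 1) : ℕ) : ℝ) *
      ((∏ i ∈ range (n+1), ∏ t ∈ range (n - i), (f i - f (i + 1 + t) + t + 1) : ℕ) : ℝ) := by
    rw [← Nat.cast_mul, ← prod_mul_distrib, ← Nat.cast_prod]
    congr 1
    refine prod_congr rfl fun i hi => ?_
    have hi' := mem_range.1 hi
    have h := row (f i) (fun j => f (i + 1 + j)) (fun x y hxy => hf (by omega)) (hf (by omega)) (n - i)
    rw [show f i + n - i = f i + (n - i) by omega, ← h]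
    congr 1
    refine prod_congr rfl fun b hb => ?_
    have hb := mem_range.1 hb
    have hc : #((range (n+1)).filter fun a' => b < f a') = (i + 1) + #((range (n - i)).filter fun j => b < f (i + 1 + j)) := by
      simp only [card_filter]
      rw [show n + 1 = (i + 1) + (n - i) by omega, sum_range_add]
      congr 1
      rw [sum_congr rfl (g := fun _ => 1), sum_const, card_range, smul_eq_mul, mul_one]
      intro x hx
      have hx := mem_range.1 hx
      rw [if_pos]
      exact hb.trans_le (hf (by omega))
    rw [hc]
    omega
  have hne := vand_ne n f hf
  rw [HH, eq_div_iff hne.ne', hnum, hden]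

noncomputable def pf {n : ℕ} (lam : Nat.Partition n) (i : ℕ) : ℕ := (lam.parts.sort (· ≥ ·)).getD i 0

theorem pf_len {n : ℕ} (lam : Nat.Partition n) : (lam.parts.sort (· ≥ ·)).length ≤ n := by
  rw [Multiset.length_sort]
  have h : Multiset.card lam.parts • 1 ≤ lam.parts.sum :=
    Multiset.card_nsmul_le_sum fun x hx => lam.parts_pos hx
  rw [lam.parts_sum] at h
  simpa using h

theorem getD_map (L : List ℕ) (n : ℕ) (h : L.length ≤ n) :
    (List.range n).map (fun i => L.getD i 0) = L ++ List.replicate (n - L.length) 0 := by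
  apply List.ext_getElem
  · simp; omega
  · intro i h1 h2
    simp only [List.getElem_map, List.getElem_range]
    by_cases hi : i < L.length
    · rw [List.getElem_append_left hi, List.getD_eq_getElem _ _ hi]
    · rw [List.getElem_append_right (by omega), List.getElem_replicate, List.getD_eq_default _ _ (by omega)]

theorem pf_map {n : ℕ} (lam : Nat.Partition n) :
    (range n).val.map (pf lam) = lam.parts + Multiset.replicate (n - (lam.parts.sort (· ≥ ·)).length) 0 := by
  have h := congrArg (fun l : List ℕ => (l : Multiset ℕ)) (getD_map _ n (pf_len lam))
  simp only [← Multiset.coe_add, Multiset.sort_eq, ← Multiset.map_coe] at h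
  exact h

theorem pf_parts {n : ℕ} (lam : Nat.Partition n) : ((range n).val.map (pf lam)).filter (· ≠ 0) = lam.parts := by
  rw [pf_map, Multiset.filter_add, Multiset.filter_eq_self.2, Multiset.filter_eq_nil.2, add_zero]
  · intro a ha
    simp [Multiset.eq_of_mem_replicate ha]
  · intro a ha
    exact (lam.parts_pos ha).ne'

theorem pf_sh {n : ℕ} (lam : Nat.Partition n) : IsSh n (pf lam) where
  anti := by
    intro i j hij
    unfold pf
    set L := lam.parts.sort (· ≥ ·) with hL
    have hs : L.Pairwise (· ≥ ·) := Multiset.pairwise_sort _ _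
    by_cases hj : j < L.length
    · rw [List.getD_eq_getElem _ _ hj, List.getD_eq_getElem _ _ (by omega)]
      rcases hij.lt_or_eq with h | rfl
      · exact List.pairwise_iff_getElem.1 hs i j (by omega) hj h
      · exact le_rfl
    · rw [List.getD_eq_default _ _ (by omega)]
      exact Nat.zero_le _
  zero := by
    intro i hi
    exact List.getD_eq_default _ _ ((pf_len lam).trans hi)
  sum := by
    have h := congrArg Multiset.sum (pf_map lam)
    rw [Multiset.sum_add, lam.parts_sum] at h
    rw [Multiset.sum_replicate, smul_zero, add_zero] at h
    exact h

theorem sh_unique {n : ℕ} {f g : ℕ → ℕ} (hf : IsSh n f) (hg : IsSh n g)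
    (h : ((range n).val.map f).filter (· ≠ 0) = ((range n).val.map g).filter (· ≠ 0)) : f = g := by
  by_contra hne
  obtain ⟨i, hi⟩ := exists_lt hf hg hne
  have key : ∀ f : ℕ → ℕ, ∀ c, Multiset.card ((((range n).val.map f).filter (· ≠ 0)).filter (c < ·)) =
      #((range n).filter fun j => c < f j) := by
    intro f c
    rw [Multiset.filter_filter, Multiset.filter_map, Multiset.card_map, card_def, filter_val]
    congr 1
    apply Multiset.filter_congr
    intro x _
    simp only [Function.comp]
    omega
  have h1 := key f (f i)
  rw [h, key g (f i)] at h1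
  have hin : i < n := by
    by_contra hin
    rw [hg.zero i (by omega)] at hi
    omega
  have h2 : (range n).filter (fun j => f i < f j) ⊆ range i := by
    intro j hj
    rw [mem_filter] at hj
    rw [mem_range]
    by_contra hij
    have := hf.anti (show i ≤ j by omega)
    omega
  have h3 : range (i + 1) ⊆ (range n).filter (fun j => f i < g j) := by
    intro j hj
    rw [mem_range] at hj
    rw [mem_filter, mem_range]
    have := hg.anti (show j ≤ i by omega)
    omega
  have h2 := card_le_card h2
  have h3 := card_le_card h3
  rw [card_range] at h2 h3
  omega

theorem pf_inj {n : ℕ} : Function.Injective (pf (n := n)) := by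
  intro a b h
  apply Nat.Partition.ext
  rw [← pf_parts a, ← pf_parts b, h]

theorem pf_surj {n : ℕ} {f : ℕ → ℕ} (hf : IsSh n f) : ∃ lam : Nat.Partition n, pf lam = f := by
  refine ⟨Nat.Partition.ofSums n ((range n).val.map f) hf.sum, sh_unique (pf_sh _) hf ?_⟩
  rw [pf_parts]
  rfl

theorem content_pf {n : ℕ} (q : ℝ) (lam : Nat.Partition n) : contentProd q lam = eps n q (pf lam) := by
  unfold contentProd eps
  refine prod_subset (range_mono (pf_len lam)) fun i _ hi => ?_
  rw [List.getD_eq_default _ _ (by simpa using hi)]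
  simp

theorem hook_pf {n : ℕ} (lam : Nat.Partition n) : (hookProd lam : ℝ) = HH n (pf lam) := by
  rw [← hook_eq n (pf lam) (pf_sh lam).anti]
  congr 1
  unfold hookProd
  have hl := pf_len lam
  have hcnt : ∀ b, #((range (lam.parts.sort (· ≥ ·)).length).filter fun a' => b < (lam.parts.sort (· ≥ ·)).getD a' 0) =
      #((range (n+1)).filter fun a' => b < pf lam a') := by
    intro b
    congr 1
    ext x
    simp only [mem_filter, mem_range]
    constructor
    · rintro ⟨h1, h2⟩
      exact ⟨by omega, h2⟩
    · rintro ⟨h1, h2⟩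
      refine ⟨?_, h2⟩
      by_contra hx
      rw [pf, List.getD_eq_default _ _ (by omega)] at h2
      omega
  simp only [hcnt]
  refine prod_subset (range_mono (by omega)) fun i _ hi => ?_
  rw [List.getD_eq_default _ _ (by simpa using hi)]
  simp

end part

theorem wc_main (k : ℕ) (hk : 3 ≤ k) (hko : Odd k) (n : ℕ) (q : ℝ) :
    ∑ v : Fin k → Equiv.Perm (Fin n), q ^ numCycles (wc v) =
      (n.factorial : ℝ) ^ 2 * ∑ lam : Nat.Partition n, (hookProd lam : ℝ) ^ (k - 3) * contentProd q lam := by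
  obtain ⟨m, rfl⟩ := hko
  obtain ⟨m, rfl⟩ : ∃ t, m = t + 1 := ⟨m - 1, by omega⟩
  rw [perm_main n ?_ m q]
  · congr 1
    rw [show 2 * (m + 1) + 1 - 3 = 2 * m by omega]
    symm
    refine sum_bij (fun lam _ => pf lam) (fun lam _ => mem_Shs.2 (pf_sh lam)) (fun a _ b _ h => pf_inj h) ?_ ?_
    · intro f hf
      obtain ⟨lam, h⟩ := pf_surj (mem_Shs.1 hf)
      exact ⟨lam, mem_univ _, h⟩
    · intro lam _
      rw [hook_pf, content_pf]
  · rw [← card_univ]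
    exact card_le_card_of_injOn pf (fun lam _ => mem_Shs.2 (pf_sh lam)) (pf_inj.injOn)

end part8

/-- Generating function for the number of cycles of `w_c(σ_1,…,σ_k)` (odd `k`):
`Σ q^{C(w_c)} = (n!)² Σ_{λ ⊢ n} H_λ^{k-3} Π_{r ∈ λ} (q + cont(r))`. -/
theorem wc_cycle_generating_function_odd (k : ℕ) (hk : 3 ≤ k) (hko : Odd k)
    (n : ℕ) (hn : 1 ≤ n) (q : ℝ) :
    ∑ v : Fin k → Equiv.Perm (Fin n), q ^ numCycles (wc v)
      = (n.factorial : ℝ) ^ 2 * ∑ lam : Nat.Partition n,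
          (hookProd lam : ℝ) ^ (k - 3) * contentProd q lam := by
  exact wc_main k hk hko n q
end

section
/- Fix k ≥ 2. There is a constant C > 0 such that for all n ≥ 1 and all t ≥ 0, #{(σ_1,…,σ_k) ∈ S_n^k : C(σ_1⋯σ_k·σ_1⁻¹⋯σ_k⁻¹) ≥ t} ≤ C · n · (n!)^k / 2^t. Equivalently, Pr[C(w_c(σ_1,…,σ_k)) ≥ t] = O(n/2^t) for uniform independent σ_1,…,σ_k ∈ S_n. -/
open Module

section PartA

variable {G : Type} [Group G] [Fintype G]

def WIrr {U : Type} [AddCommGroup U] [Module ℂ U] (τ : Representation ℂ G U) : Prop :=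
  Nontrivial U ∧ ∀ W : Submodule ℂ U, (∀ g, ∀ v ∈ W, τ g v ∈ W) → W = ⊥ ∨ W = ⊤

lemma wdecomp {V : Type} [AddCommGroup V] [Module ℂ V] [FiniteDimensional ℂ V]
    (ρ : Representation ℂ G V) :
    ∃ (m : ℕ) (S : Fin m → Subrepresentation ρ),
      DirectSum.IsInternal (fun i => (S i).toSubmodule) ∧ ∀ i, WIrr (S i).toRepresentation := by
  classical
  have : NeZero (Nat.card G : ℂ) := ⟨by exact_mod_cast Nat.card_pos.ne'⟩
  have : Module.Finite ℂ ρ.asModule := inferInstanceAs (Module.Finite ℂ V)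
  have : Module.Finite (MonoidAlgebra ℂ G) ρ.asModule :=
    Module.Finite.of_restrictScalars_finite ℂ _ _
  have ⟨s, ind, hs, simple⟩ := IsSemisimpleModule.exists_sSupIndep_sSup_simples_eq_top (MonoidAlgebra ℂ G) ρ.asModule
  have ind' := (sSupIndep_iff _).mp ind
  have fin : Finite s := WellFoundedGT.finite_of_iSupIndep ind'
    fun S ↦ (S.1.nontrivial_iff_ne_bot).mp <| (simple _ S.2).nontrivial
  let e := Finite.equivFin s
  let T : Fin (Nat.card s) → Submodule (MonoidAlgebra ℂ G) ρ.asModule := fun i => (e.symm i).1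
  have hT1 : iSupIndep T := ind'.comp e.symm.injective
  have hT2 : iSup T = ⊤ := by
    rw [← hs, sSup_eq_iSup']
    exact e.symm.surjective.iSup_comp (fun a : s => a.1)
  have hT3 : DirectSum.IsInternal T := (DirectSum.isInternal_submodule_iff_iSupIndep_and_iSup_eq_top _).2 ⟨hT1, hT2⟩
  let Φ := Subrepresentation.subrepresentationSubmoduleOrderIso (ρ := ρ)
  refine ⟨_, fun i => Φ.symm (T i), hT3, ?_⟩
  intro i
  have hsimple : IsSimpleModule (MonoidAlgebra ℂ G) (T i) := simple _ (e.symm i).2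
  have hatom : IsAtom (Φ.symm (T i)) := by
    rw [OrderIso.isAtom_iff]
    exact isSimpleModule_iff_isAtom.1 hsimple
  refine ⟨?_, ?_⟩
  · have h := hatom.1
    rw [Submodule.nontrivial_iff_ne_bot]
    intro h0
    apply h
    apply Subrepresentation.toSubmodule_injective
    exact h0
  · intro W hW
    let W' : Subrepresentation ρ := ⟨W.map (Φ.symm (T i)).toSubmodule.subtype, by
      rintro g v ⟨w, hw, rfl⟩
      exact ⟨_, hW g w hw, rfl⟩⟩
    have hle : W' ≤ Φ.symm (T i) := by
      rintro _ ⟨w, hw, rfl⟩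
      exact w.2
    rcases hatom.le_iff.1 hle with h | h
    · left
      have h2 : W.map (Φ.symm (T i)).toSubmodule.subtype = ⊥ := congrArg Subrepresentation.toSubmodule h
      rw [eq_bot_iff]
      intro w hw
      have : (w : V) ∈ W.map (Φ.symm (T i)).toSubmodule.subtype := ⟨w, hw, rfl⟩
      rw [h2] at this
      simpa using this
    · right
      have h2 : W.map (Φ.symm (T i)).toSubmodule.subtype = (Φ.symm (T i)).toSubmodule := congrArg Subrepresentation.toSubmodule h
      rw [eq_top_iff]
      intro w _
      have : (w : V) ∈ W.map (Φ.symm (T i)).toSubmodule.subtype := by rw [h2]; exact w.2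
      obtain ⟨w', hw', h⟩ := this
      have : w' = w := Subtype.ext h
      exact this ▸ hw'

variable {U : Type} [AddCommGroup U] [Module ℂ U] [FiniteDimensional ℂ U]

lemma wschur {τ : Representation ℂ G U} (h : WIrr τ) (f : End ℂ U)
    (hf : ∀ g, f * τ g = τ g * f) : ∃ c : ℂ, f = c • 1 := by
  have := h.1
  obtain ⟨c, hc⟩ := Module.End.exists_eigenvalue f
  refine ⟨c, ?_⟩
  rcases h.2 (f.eigenspace c) (by
    intro g v hv
    rw [Module.End.mem_eigenspace_iff] at hv ⊢
    have := LinearMap.congr_fun (hf g) v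
    simp only [Module.End.mul_apply, hv, map_smul] at this
    exact this) with h1 | h1
  · exact absurd h1 hc
  · ext v
    have : v ∈ f.eigenspace c := by rw [h1]; trivial
    rw [Module.End.mem_eigenspace_iff] at this
    simpa using this

lemma wavg {τ : Representation ℂ G U} (h : WIrr τ) (Y : End ℂ U) :
    ∑ a, τ a * Y * τ a⁻¹ = ((Fintype.card G : ℂ) * LinearMap.trace ℂ U Y / finrank ℂ U) • 1 := by
  have := h.1
  obtain ⟨c, hc⟩ := wschur h (∑ a, τ a * Y * τ a⁻¹) (by
    intro g
    rw [Finset.sum_mul, Finset.mul_sum]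
    refine Fintype.sum_equiv (Equiv.mulLeft g⁻¹) _ _ ?_
    intro a
    simp only [Equiv.coe_mulLeft, mul_inv_rev, inv_inv, map_mul, ← mul_assoc]
    rw [← map_mul]; simp)
  have ht := congrArg (LinearMap.trace ℂ U) hc
  have h1 : ∀ a, LinearMap.trace ℂ U (τ a * Y * τ a⁻¹) = LinearMap.trace ℂ U Y := by
    intro a
    rw [LinearMap.trace_mul_comm, ← mul_assoc, ← map_mul]; simp
  rw [map_sum, Finset.sum_congr rfl (fun a _ => h1 a)] at ht
  simp only [Finset.sum_const, Finset.card_univ, nsmul_eq_mul, map_smul, LinearMap.trace_one, smul_eq_mul] at ht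
  have hd : (finrank ℂ U : ℂ) ≠ 0 := by exact_mod_cast finrank_pos.ne'
  rw [hc, ht]
  congr 1
  field_simp

lemma wchar {τ : Representation ℂ G U} (h : WIrr τ) :
    ∑ a, LinearMap.trace ℂ U (τ a) • τ a⁻¹ = ((Fintype.card G : ℂ) / finrank ℂ U) • 1 := by
  classical
  let b := finBasis ℂ U
  apply b.ext
  intro l
  have key : ∀ i j : Fin (finrank ℂ U), ∑ a, (b.repr (τ a (b i)) i) • τ a⁻¹ (b j) =
      ((Fintype.card G : ℂ) / finrank ℂ U) • (if i = j then b i else 0) := by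
    intro i j
    let Y : End ℂ U := LinearMap.toSpanSingleton ℂ U (b j) ∘ₗ b.coord i
    have h1 := LinearMap.congr_fun (wavg h Y) (b i)
    have h2 : LinearMap.trace ℂ U Y = if i = j then 1 else 0 := by
      have : Y = dualTensorHom ℂ U U (b.coord i ⊗ₜ b j) := by
        ext v; simp [Y]
      rw [this, LinearMap.trace_eq_contract_apply]
      simp [Finsupp.single_apply, eq_comm]
    rw [h2] at h1
    simp only [LinearMap.sum_apply, Module.End.mul_apply, Y, LinearMap.comp_apply, Basis.coord_apply,
      LinearMap.toSpanSingleton_apply, map_smul, LinearMap.smul_apply, Module.End.one_apply] at h1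
    rw [← Equiv.sum_comp (Equiv.inv G)]
    simp only [Equiv.inv_apply, inv_inv]
    rw [h1]
    split_ifs <;> simp
  have htr : ∀ a, LinearMap.trace ℂ U (τ a) = ∑ i, b.repr (τ a (b i)) i := by
    intro a
    rw [LinearMap.trace_eq_matrix_trace ℂ b, Matrix.trace]
    simp [LinearMap.toMatrix_apply]
  simp only [LinearMap.sum_apply, LinearMap.smul_apply, htr, Finset.sum_smul]
  rw [Finset.sum_comm]
  simp only [key]
  simp

lemma wcomm {τ : Representation ℂ G U} (h : WIrr τ) (Q R : G) :
    ∑ b, ∑ a, LinearMap.trace ℂ U (τ (a * b * a⁻¹ * Q * b⁻¹ * R)) =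
      ((Fintype.card G : ℂ) / finrank ℂ U) ^ 2 * LinearMap.trace ℂ U (τ (Q * R)) := by
  have h1 : ∀ b, ∑ a, τ (a * b * a⁻¹ * Q * b⁻¹ * R) =
      ((Fintype.card G : ℂ) / finrank ℂ U) • (τ Q * (LinearMap.trace ℂ U (τ b) • τ b⁻¹) * τ R) := by
    intro b
    have : ∀ a, τ (a * b * a⁻¹ * Q * b⁻¹ * R) = (τ a * τ b * τ a⁻¹) * (τ Q * τ b⁻¹ * τ R) := by
      intro a; simp only [map_mul, mul_assoc]
    simp only [this]
    rw [← Finset.sum_mul, wavg h]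
    simp only [smul_mul_assoc, one_mul, mul_smul_comm, smul_smul]
    congr 1; ring
  have h2 : ∑ b, ∑ a, τ (a * b * a⁻¹ * Q * b⁻¹ * R) =
      ((Fintype.card G : ℂ) / finrank ℂ U) ^ 2 • τ (Q * R) := by
    simp only [h1]
    rw [← Finset.smul_sum, ← Finset.sum_mul, ← Finset.mul_sum, wchar h]
    simp [smul_smul, sq]
  have h3 := congrArg (LinearMap.trace ℂ U) h2
  simpa [map_sum] using h3

lemma wtr (τ : Representation ℂ G U) (g : G) : ‖LinearMap.trace ℂ U (τ g)‖ ≤ finrank ℂ U := by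
  have hs : (τ g).charpoly.Splits := IsAlgClosed.splits _
  rw [Module.End.trace_eq_sum_roots_charpoly_of_splits hs]
  have hr : ∀ z ∈ (τ g).charpoly.roots, ‖z‖ = 1 := by
    intro z hz
    have h1 : Module.End.HasEigenvalue (τ g) z := by
      rw [Module.End.hasEigenvalue_iff_isRoot_charpoly]
      exact Polynomial.isRoot_of_mem_roots hz
    obtain ⟨v, hv⟩ := h1.exists_hasEigenvector
    have h2 := hv.pow_apply (Fintype.card G)
    rw [← map_pow τ, pow_card_eq_one, map_one, Module.End.one_apply] at h2
    have h3 : z ^ Fintype.card G = 1 := by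
      by_contra hne
      have : (z ^ Fintype.card G - 1) • v = 0 := by rw [sub_smul, ← h2]; simp
      rcases smul_eq_zero.1 this with h | h
      · exact hne (sub_eq_zero.1 h)
      · exact hv.2 h
    exact Complex.norm_eq_one_of_pow_eq_one h3 Fintype.card_ne_zero
  calc ‖(τ g).charpoly.roots.sum‖ ≤ ((τ g).charpoly.roots.map (fun z => ‖z‖)).sum := by
        simpa using norm_multiset_sum_le (τ g).charpoly.roots
    _ = Multiset.card (τ g).charpoly.roots := by
        rw [Multiset.map_congr rfl hr]; simp
    _ ≤ (τ g).charpoly.natDegree := by exact_mod_cast Polynomial.card_roots' _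
    _ = finrank ℂ U := by rw [LinearMap.charpoly_natDegree]

lemma wtotal {V : Type} [AddCommGroup V] [Module ℂ V] [FiniteDimensional ℂ V]
    (ρ : Representation ℂ G V) {m : ℕ} (S : Fin m → Subrepresentation ρ)
    (hS : DirectSum.IsInternal (fun i => (S i).toSubmodule))
    (hI : ∀ i, WIrr (S i).toRepresentation) (Q R : G) :
    ‖∑ b, ∑ a, LinearMap.trace ℂ V (ρ (a * b * a⁻¹ * Q * b⁻¹ * R))‖ ≤
      (Fintype.card G : ℝ) ^ 2 * ∑ i, 1 / (finrank ℂ (S i).toSubmodule : ℝ) := by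
  classical
  have h1 : ∀ g, LinearMap.trace ℂ V (ρ g) =
      ∑ i, LinearMap.trace ℂ (S i).toSubmodule ((S i).toRepresentation g) := by
    intro g
    exact LinearMap.trace_eq_sum_trace_restrict hS (f := ρ g)
      (fun i v hv => (S i).apply_mem_toSubmodule g hv)
  have h2 : ∑ b, ∑ a, LinearMap.trace ℂ V (ρ (a * b * a⁻¹ * Q * b⁻¹ * R)) =
      ∑ i, ((Fintype.card G : ℂ) / finrank ℂ (S i).toSubmodule) ^ 2 *
        LinearMap.trace ℂ (S i).toSubmodule ((S i).toRepresentation (Q * R)) := by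
    simp only [h1]
    simp only [← wcomm (hI _)]
    rw [Finset.sum_comm]
    conv_rhs => rw [Finset.sum_comm]
    rw [Finset.sum_comm]
    refine Finset.sum_congr rfl fun b _ => ?_
    rw [Finset.sum_comm]
  rw [h2, Finset.mul_sum]
  refine (norm_sum_le _ _).trans (Finset.sum_le_sum fun i _ => ?_)
  have := (hI i).1
  have hd : (0 : ℝ) < finrank ℂ (S i).toSubmodule := by exact_mod_cast finrank_pos
  rw [norm_mul, norm_pow, norm_div]
  simp only [Complex.norm_natCast]
  calc _ ≤ ((Fintype.card G : ℝ) / finrank ℂ (S i).toSubmodule) ^ 2 * finrank ℂ (S i).toSubmodule := by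
        gcongr
        exact wtr _ _
    _ = _ := by field_simp

end PartA

section PartB

variable {U : Type} [AddCommGroup U] [Module ℂ U] [FiniteDimensional ℂ U]

lemma weig (T : End ℂ U) (p : ℕ) (hp : p.Prime) (hT : T ^ p = 1)
    (hc : ∀ k, 0 < k → k < p → ∃ A B : End ℂ U, B * A = 1 ∧ T ^ k = A * T * B)
    (hd : finrank ℂ U < p - 1) : T = 1 := by
  classical
  by_contra hne
  let W := LinearMap.range (T - 1)
  have hW : Nontrivial W := by
    rw [Submodule.nontrivial_iff_ne_bot]
    intro h
    exact hne (sub_eq_zero.1 (LinearMap.range_eq_bot.1 h))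
  have hWT : ∀ v ∈ W, T v ∈ W := by
    rintro _ ⟨u, rfl⟩
    exact ⟨T u, by simp⟩
  obtain ⟨μ, hμ⟩ := Module.End.exists_eigenvalue (T.restrict hWT)
  obtain ⟨⟨v, hvW⟩, hv⟩ := hμ.exists_hasEigenvector
  have hv0 : v ≠ 0 := fun h => hv.2 (Subtype.ext h)
  have hTv : T v = μ • v := congrArg Subtype.val hv.apply_eq_smul
  have hTk : ∀ k : ℕ, (T ^ k) v = μ ^ k • v := by
    intro k
    induction k with
    | zero => simp
    | succ k ih => rw [pow_succ', Module.End.mul_apply, ih, map_smul, hTv, smul_smul, pow_succ]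
  have hsum : (∑ k ∈ Finset.range p, μ ^ k) = 0 := by
    obtain ⟨u, hu⟩ := hvW
    have h1 : (∑ k ∈ Finset.range p, T ^ k) * (T - 1) = 0 := by
      rw [geom_sum_mul, hT, sub_self]
    have h2 := LinearMap.congr_fun h1 u
    rw [Module.End.mul_apply, hu, LinearMap.sum_apply] at h2
    simp only [hTk, ← Finset.sum_smul, LinearMap.zero_apply] at h2
    exact (smul_eq_zero.1 h2).resolve_right hv0
  have hμ1 : μ ≠ 1 := by
    rintro rfl
    simp at hsum
    exact hp.ne_zero hsum
  have hμp : μ ^ p = 1 := by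
    have := geom_sum_mul μ p
    rw [hsum, zero_mul] at this
    exact (sub_eq_zero.1 this.symm)
  have hprim : IsPrimitiveRoot μ p := by
    have : Fact p.Prime := ⟨hp⟩
    have h := orderOf_eq_prime hμp hμ1
    exact h ▸ IsPrimitiveRoot.orderOf μ
  have hroot : ∀ k ∈ Finset.Ico 1 p, μ ^ k ∈ T.charpoly.roots.toFinset := by
    intro k hk
    rw [Finset.mem_Ico] at hk
    obtain ⟨A, B, hBA, hAB⟩ := hc k hk.1 hk.2
    rw [Multiset.mem_toFinset, Polynomial.mem_roots (LinearMap.charpoly_monic T).ne_zero,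
      ← Module.End.hasEigenvalue_iff_isRoot_charpoly]
    refine Module.End.hasEigenvalue_of_hasEigenvector (x := B v) ⟨?_, ?_⟩
    · rw [Module.End.mem_eigenspace_iff]
      have h1 := hTk k
      rw [hAB] at h1
      have h2 := congrArg B h1
      simp only [Module.End.mul_apply, map_smul] at h2
      rw [← h2]
      exact (LinearMap.congr_fun hBA (T (B v))).symm
    · intro h0
      have h1 := hTk k
      rw [hAB] at h1
      simp only [Module.End.mul_apply, h0, map_zero] at h1
      rcases smul_eq_zero.1 h1.symm with h | h
      · have : μ ≠ 0 := hprim.ne_zero hp.ne_zero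
        exact pow_ne_zero k this h
      · exact hv0 h
  have hcard : p - 1 ≤ finrank ℂ U := by
    calc p - 1 = (Finset.Ico 1 p).card := by simp
      _ ≤ T.charpoly.roots.toFinset.card := by
          refine Finset.card_le_card_of_injOn (fun k => μ ^ k) hroot ?_
          intro a ha b hb hab
          simp only [Finset.coe_Ico, Set.mem_Ico] at ha hb
          exact hprim.pow_inj ha.2 hb.2 hab
      _ ≤ Multiset.card T.charpoly.roots := Multiset.toFinset_card_le _
      _ ≤ T.charpoly.natDegree := Polynomial.card_roots' _
      _ = finrank ℂ U := LinearMap.charpoly_natDegree _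
  omega

lemma wcycle_three {α : Type} [Fintype α] [DecidableEq α] (N : Subgroup (Equiv.Perm α)) [hN : N.Normal]
    (c : Equiv.Perm α) (hc : c.IsCycle) (h3 : 3 ≤ orderOf c) (hcN : c ∈ N)
    (t : Equiv.Perm α) (ht : t.IsThreeCycle) : t ∈ N := by
  obtain ⟨x, hx, -⟩ := id hc
  have hxy : x ≠ c x := fun h => hx h.symm
  have hyz : c x ≠ c (c x) := fun h => hxy (c.injective h)
  have hxz : x ≠ c (c x) := by
    intro h
    have : c ^ 2 = 1 := hc.pow_eq_one_iff.2 ⟨x, hx, by rw [sq, Equiv.Perm.mul_apply]; exact h.symm⟩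
    have := orderOf_le_of_pow_eq_one (by norm_num) this
    omega
  have h1 : Equiv.swap (c x) (c (c x)) * Equiv.swap (c x) x ∈ N := by
    have : Equiv.swap (c x) (c (c x)) * Equiv.swap (c x) x =
        c * (Equiv.swap x (c x) * c⁻¹ * (Equiv.swap x (c x))⁻¹) := by
      rw [Equiv.swap_inv, Equiv.swap_comm (c x) x, ← mul_assoc, ← mul_assoc]
      congr 1
      rw [Equiv.swap_apply_apply]
    rw [this]
    exact N.mul_mem hcN (hN.conj_mem _ (N.inv_mem hcN) _)
  have h2 : (Equiv.swap (c x) (c (c x)) * Equiv.swap (c x) x).IsThreeCycle :=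
    Equiv.Perm.isThreeCycle_swap_mul_swap_same hyz hxy.symm hxz.symm
  have h3 : IsConj (Equiv.swap (c x) (c (c x)) * Equiv.swap (c x) x) t := by
    rw [Equiv.Perm.isConj_iff_cycleType_eq, h2.cycleType, ht.cycleType]
  obtain ⟨g, hg⟩ := isConj_iff.1 h3
  rw [← hg]
  exact hN.conj_mem _ h1 _

lemma wsmall {n p : ℕ} (hp : p.Prime) (hp3 : 3 ≤ p) (hpn : p ≤ n)
    (τ : Representation ℂ (Equiv.Perm (Fin n)) U) (hd : finrank ℂ U < p - 1)
    (t : Equiv.Perm (Fin n)) (ht : t.IsThreeCycle) : τ t = 1 := by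
  obtain ⟨c, hc⟩ := (Equiv.Perm.exists_with_cycleType_iff (Fin n) (m := {p})).2
    ⟨by simpa using hpn, by simpa using hp.two_le⟩
  have hcyc : c.IsCycle := Equiv.Perm.card_cycleType_eq_one.1 (by rw [hc]; simp)
  have hord : orderOf c = p := by rw [← Equiv.Perm.lcm_cycleType, hc]; simp
  have h1 : τ c = 1 := by
    apply weig (τ c) p hp _ _ hd
    · rw [← map_pow, ← hord, pow_orderOf_eq_one, map_one]
    · intro k hk hkp
      have hk' : (c ^ k).IsCycle := hcyc.isCycle_pow_pos_of_lt_prime_order (hord ▸ hp) k hk (hord ▸ hkp)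
      have hok : orderOf (c ^ k) = p := by
        have : Nat.Coprime (orderOf c) k := by
          rw [hord]; exact Nat.coprime_of_lt_prime hk.ne' hkp hp
        rw [this.orderOf_pow, hord]
      have : IsConj c (c ^ k) := by
        rw [Equiv.Perm.isConj_iff_cycleType_eq, hcyc.cycleType, hk'.cycleType, ← hcyc.orderOf,
          ← hk'.orderOf, hok, hord]
      obtain ⟨g, hg⟩ := isConj_iff.1 this
      refine ⟨τ g, τ g⁻¹, by rw [← map_mul]; simp, ?_⟩
      rw [← map_pow, ← hg, map_mul, map_mul]
  exact wcycle_three (MonoidHom.ker τ) c hcyc (hord ▸ hp3) h1 t ht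

end PartB

section PartC

lemma wfiber {n : ℕ} {γ : Type} [Fintype γ] [DecidableEq γ] (f f' : Fin n → γ)
    (h : ∀ c, (Finset.univ.filter fun i => f i = c).card = (Finset.univ.filter fun i => f' i = c).card) :
    ∃ g : Equiv.Perm (Fin n), ∀ i, f (g i) = f' i := by
  have e : ∀ c, Nonempty ({i // f' i = c} ≃ {i // f i = c}) := by
    intro c
    refine ⟨Fintype.equivOfCardEq ?_⟩
    rw [Fintype.card_subtype, Fintype.card_subtype, h]
  exact ⟨Equiv.ofFiberEquiv (fun c => (e c).some), fun i => Equiv.ofFiberEquiv_map _ i⟩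

/-- colourings with exactly `j` true values -/
abbrev WX (n j : ℕ) : Type := {x : Fin n → Bool // (Finset.univ.filter fun i => x i = true).card = j}

def wact {n j : ℕ} (g : Equiv.Perm (Fin n)) (x : WX n j) : WX n j :=
  ⟨fun i => x.1 (g i), by
    refine Eq.trans ?_ x.2
    exact Finset.card_equiv g (by simp)⟩

def wrep (n j : ℕ) : Representation ℂ (Equiv.Perm (Fin n)) (WX n j → ℂ) where
  toFun g := LinearMap.funLeft ℂ ℂ (wact g)
  map_one' := by ext; simp [LinearMap.funLeft_apply, wact]
  map_mul' a b := by ext; simp [LinearMap.funLeft_apply, wact]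

lemma wrep_apply {n j : ℕ} (g : Equiv.Perm (Fin n)) (F : WX n j → ℂ) (x : WX n j) :
    wrep n j g F x = F (wact g x) := rfl

lemma wtrace {n j : ℕ} (g : Equiv.Perm (Fin n)) :
    LinearMap.trace ℂ _ (wrep n j g) = (Finset.univ.filter fun x : WX n j => wact g x = x).card := by
  rw [LinearMap.trace_eq_matrix_trace ℂ (Pi.basisFun ℂ (WX n j)), Matrix.trace]
  simp [LinearMap.toMatrix_apply, wrep_apply, Pi.single_apply]

lemma wtrans {n j : ℕ} (x x' : WX n j) : ∃ g, wact g x = x' := by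
  obtain ⟨g, hg⟩ := wfiber x.1 x'.1 (by
    intro c
    cases c
    · have h1 := Finset.card_filter_add_card_filter_not (s := Finset.univ) (fun i => x.1 i = true)
      have h2 := Finset.card_filter_add_card_filter_not (s := Finset.univ) (fun i => x'.1 i = true)
      simp only [Bool.not_eq_true] at h1 h2
      have := x.2
      have := x'.2
      omega
    · rw [x.2, x'.2])
  exact ⟨g, Subtype.ext (funext hg)⟩

lemma wsplit {n : ℕ} (x y : Fin n → Bool) (b : Bool) :
    (Finset.univ.filter fun i => x i = b).card =
      (Finset.univ.filter fun i => x i = b ∧ y i = true).card +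
      (Finset.univ.filter fun i => x i = b ∧ y i = false).card := by
  rw [← Finset.card_filter_add_card_filter_not (fun i => y i = true), Finset.filter_filter, Finset.filter_filter]
  simp

lemma wtrans2 {n j : ℕ} (x x' x0 : WX n j)
    (h : (Finset.univ.filter fun i => x.1 i = true ∧ x0.1 i = true).card =
      (Finset.univ.filter fun i => x'.1 i = true ∧ x0.1 i = true).card) :
    ∃ g, wact g x = x' ∧ wact g x0 = x0 := by
  obtain ⟨g, hg⟩ := wfiber (fun i => (x.1 i, x0.1 i)) (fun i => (x'.1 i, x0.1 i)) (by
    have hc : ∀ (a b : Fin n → Bool) (s t : Bool), (Finset.univ.filter fun i => a i = s ∧ b i = t).card =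
      (Finset.univ.filter fun i => b i = t ∧ a i = s).card := by
      intro a b s t; simp only [and_comm]
    have a1 := wsplit x.1 x0.1 true
    have a2 := wsplit x'.1 x0.1 true
    have a3 := wsplit x0.1 x.1 true
    have a4 := wsplit x0.1 x'.1 true
    have a5 := wsplit x0.1 x.1 false
    have a6 := wsplit x0.1 x'.1 false
    rw [x.2] at a1
    rw [x'.2] at a2
    rw [x0.2] at a3 a4
    rw [hc x0.1] at a3 a4 a5 a6
    rw [hc x0.1] at a3 a4 a5 a6
    rintro ⟨s, t⟩
    simp only [Prod.mk.injEq]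
    cases s <;> cases t <;> omega)
  refine ⟨g, Subtype.ext (funext fun i => congrArg Prod.fst (hg i)),
    Subtype.ext (funext fun i => congrArg Prod.snd (hg i))⟩

lemma wconst {n j : ℕ} (hn : 3 ≤ n) (F : WX n j → ℂ)
    (hF : ∀ t : Equiv.Perm (Fin n), t.IsThreeCycle → wrep n j t F = F) (x x' : WX n j) : F x = F x' := by
  let K : Subgroup (Equiv.Perm (Fin n)) :=
    { carrier := {g | wrep n j g F = F}
      one_mem' := by simp
      mul_mem' := by
        intro a b ha hb
        simp only [Set.mem_setOf_eq] at ha hb ⊢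
        rw [map_mul, Module.End.mul_apply, hb, ha]
      inv_mem' := by
        intro a ha
        simp only [Set.mem_setOf_eq] at ha ⊢
        conv_lhs => rw [← ha]
        rw [← Module.End.mul_apply, ← map_mul]; simp }
  have hK : alternatingGroup (Fin n) ≤ K := by
    rw [← Equiv.Perm.closure_three_cycles_eq_alternating, Subgroup.closure_le]
    exact fun t ht => hF t ht
  have key : ∃ g ∈ alternatingGroup (Fin n), wact g x = x' := by
    obtain ⟨g, hg⟩ := wtrans x x'
    rcases Int.units_eq_one_or (Equiv.Perm.sign g) with h | h
    · exact ⟨g, h, hg⟩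
    · obtain ⟨u, v, huv, he⟩ := Fintype.exists_ne_map_eq_of_card_lt x'.1 (by simp; omega)
      refine ⟨g * Equiv.swap u v, ?_, ?_⟩
      · rw [Equiv.Perm.mem_alternatingGroup, map_mul, h, Equiv.Perm.sign_swap huv]; rfl
      · have h1 : wact (g * Equiv.swap u v) x = wact (Equiv.swap u v) (wact g x) := rfl
        rw [h1, hg]
        apply Subtype.ext
        funext i
        change x'.1 (Equiv.swap u v i) = x'.1 i
        rw [Equiv.swap_apply_def]
        split_ifs with h1 h2
        · rw [h1, he]
        · rw [h2, he]
        · rfl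
  obtain ⟨g, hg, hgx⟩ := key
  have h1 : wrep n j g F = F := hK hg
  rw [← hgx, ← wrep_apply g F x, h1]

lemma wuniq {V : Type} [AddCommGroup V] [Module ℂ V] {m : ℕ} (S : Fin m → Submodule ℂ V)
    (hS : DirectSum.IsInternal S) (d d' : ∀ i, S i) (h : ∑ i, (d i : V) = ∑ i, (d' i : V)) : d = d' := by
  classical
  have h1 := hS.injective (a₁ := DFinsupp.equivFunOnFintype.symm d) (a₂ := DFinsupp.equivFunOnFintype.symm d') (by
    rw [DirectSum.coeAddMonoidHom_eq_dfinsuppSum, DirectSum.coeAddMonoidHom_eq_dfinsuppSum,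
      DFinsupp.sum_eq_sum_fintype _ (by simp), DFinsupp.sum_eq_sum_fintype _ (by simp)]
    exact h)
  exact DFinsupp.equivFunOnFintype.symm.injective h1

lemma wexists {V : Type} [AddCommGroup V] [Module ℂ V] {m : ℕ} (S : Fin m → Submodule ℂ V)
    (hS : DirectSum.IsInternal S) (v : V) : ∃ d : ∀ i, S i, ∑ i, (d i : V) = v := by
  classical
  obtain ⟨d, hd⟩ := hS.surjective v
  refine ⟨fun i => d i, ?_⟩
  rw [← hd, DirectSum.coeAddMonoidHom_eq_dfinsuppSum, DFinsupp.sum_eq_sum_fintype _ (by simp)]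
  rfl

lemma wcount {n j m : ℕ} (S : Fin m → Subrepresentation (wrep n j))
    (hS : DirectSum.IsInternal (fun i => (S i).toSubmodule))
    (hI : ∀ i, WIrr (S i).toRepresentation) : m ≤ j + 1 := by
  classical
  have hind := hS.submodule_iSupIndep
  rcases isEmpty_or_nonempty (WX n j) with hX | ⟨⟨x0⟩⟩
  · rcases Nat.eq_zero_or_pos m with h | h
    · omega
    · have := (hI ⟨0, h⟩).1
      obtain ⟨a, b, hab⟩ := this
      exact absurd (Subtype.ext (Subsingleton.elim _ _)) hab
  obtain ⟨d, hd⟩ := wexists _ hS (Pi.single x0 (1 : ℂ))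
  have hsing : ∀ (h : Equiv.Perm (Fin n)) (x y : WX n j), wact h x = y →
      wrep n j h (Pi.single y (1 : ℂ)) = Pi.single x 1 := by
    intro h x y hxy
    funext z
    rw [wrep_apply, Pi.single_apply, Pi.single_apply]
    have : wact h z = y ↔ z = x := by
      constructor
      · intro hz
        rw [← hxy] at hz
        apply Subtype.ext
        funext i
        have := congrFun (congrArg Subtype.val hz) (h⁻¹ i)
        simpa [wact] using this
      · rintro rfl; exact hxy
    simp only [this]
  have hne : ∀ i, (d i : WX n j → ℂ) ≠ 0 := by
    intro i h0
    let W : Submodule ℂ (WX n j → ℂ) := ⨆ k, ⨆ (_ : k ≠ i), (S k).toSubmodule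
    have hWinv : ∀ g, ∀ v ∈ W, wrep n j g v ∈ W := by
      intro g
      have : W ≤ W.comap (wrep n j g) := by
        refine iSup₂_le fun k hk v hv => ?_
        exact Submodule.mem_iSup_of_mem k (Submodule.mem_iSup_of_mem hk ((S k).apply_mem_toSubmodule g hv))
      exact fun v hv => this hv
    have h1 : Pi.single x0 (1 : ℂ) ∈ W := by
      rw [← hd]
      refine Submodule.sum_mem _ fun k _ => ?_
      by_cases hk : k = i
      · subst hk; rw [h0]; exact W.zero_mem
      · exact Submodule.mem_iSup_of_mem k (Submodule.mem_iSup_of_mem hk (d k).2)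
    have h2 : W = ⊤ := by
      rw [eq_top_iff, ← (Pi.basisFun ℂ (WX n j)).span_eq, Submodule.span_le]
      rintro _ ⟨x, rfl⟩
      obtain ⟨g, hg⟩ := wtrans x x0
      rw [Pi.basisFun_apply, ← hsing g x x0 hg]
      exact hWinv _ _ h1
    have h3 := hind i
    change Disjoint _ W at h3
    rw [h2, disjoint_top] at h3
    have := (hI i).1
    exact (Submodule.nontrivial_iff_ne_bot.1 this) h3
  have hli : LinearIndependent ℂ (fun i => (d i : WX n j → ℂ)) :=
    hind.linearIndependent (fun i => (S i).toSubmodule) (fun i => (d i).2) hne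
  have hfix : ∀ g, wact g x0 = x0 → ∀ i, wrep n j g (d i) = d i := by
    intro g hg i
    let d' : ∀ i, (S i).toSubmodule := fun i => ⟨wrep n j g (d i), (S i).apply_mem_toSubmodule g (d i).2⟩
    have : d' = d := by
      apply wuniq _ hS
      change ∑ i, wrep n j g (d i) = _
      rw [← map_sum, hd, hsing g x0 x0 hg]
    exact congrArg Subtype.val (congrFun this i)
  let φ : WX n j → Fin (j + 1) := fun x =>
    ⟨(Finset.univ.filter fun i => x.1 i = true ∧ x0.1 i = true).card, by
      have := wsplit x.1 x0.1 true
      rw [x.2] at this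
      omega⟩
  let L : (Fin (j + 1) → ℂ) →ₗ[ℂ] (WX n j → ℂ) := LinearMap.funLeft ℂ ℂ φ
  have hmem : ∀ i, (d i : WX n j → ℂ) ∈ LinearMap.range L := by
    intro i
    have : Function.FactorsThrough (d i : WX n j → ℂ) φ := by
      intro x x' hxx
      obtain ⟨g, h1, h2⟩ := wtrans2 x x' x0 (congrArg Fin.val hxx)
      rw [← h1, ← wrep_apply g (d i : WX n j → ℂ) x, hfix g h2]
    refine ⟨Function.extend φ (d i : WX n j → ℂ) 0, ?_⟩
    funext x
    exact this.extend_apply 0 x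
  have hspan : Submodule.span ℂ (Set.range fun i => (d i : WX n j → ℂ)) ≤ LinearMap.range L := by
    rw [Submodule.span_le]
    rintro _ ⟨i, rfl⟩
    exact hmem i
  calc m = finrank ℂ (Submodule.span ℂ (Set.range fun i => (d i : WX n j → ℂ))) := by
        rw [finrank_span_eq_card hli]; simp
    _ ≤ finrank ℂ (LinearMap.range L) := Submodule.finrank_mono hspan
    _ ≤ finrank ℂ (Fin (j + 1) → ℂ) := LinearMap.finrank_range_le L
    _ = j + 1 := by simp

lemma wonesmall {n j m p : ℕ} (hp : p.Prime) (hp3 : 3 ≤ p) (hpn : p ≤ n)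
    (S : Fin m → Subrepresentation (wrep n j))
    (hS : DirectSum.IsInternal (fun i => (S i).toSubmodule))
    (hI : ∀ i, WIrr (S i).toRepresentation) (i k : Fin m)
    (hi : finrank ℂ (S i).toSubmodule < p - 1) (hk : finrank ℂ (S k).toSubmodule < p - 1) : i = k := by
  have one : ∀ i, finrank ℂ (S i).toSubmodule < p - 1 → (fun _ => (1 : ℂ)) ∈ (S i).toSubmodule := by
    intro i hi
    have := (hI i).1
    obtain ⟨v, hv⟩ := exists_ne (0 : (S i).toSubmodule)
    have hc := wconst (hp3.trans hpn) (v : WX n j → ℂ) (by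
      intro t ht
      have := wsmall hp hp3 hpn (S i).toRepresentation hi t ht
      exact congrArg Subtype.val (LinearMap.congr_fun this v))
    have hv' : (v : WX n j → ℂ) ≠ 0 := fun h => hv (Subtype.ext h)
    obtain ⟨x, hx⟩ := Function.ne_iff.1 hv'
    simp only [Pi.zero_apply] at hx
    have : (fun _ => (1 : ℂ)) = ((v : WX n j → ℂ) x)⁻¹ • (v : WX n j → ℂ) := by
      funext y
      simp only [Pi.smul_apply, smul_eq_mul]
      rw [hc y x, inv_mul_cancel₀ hx]
    rw [this]
    exact Submodule.smul_mem _ _ v.2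
  by_contra hne
  have hd := hS.submodule_iSupIndep.pairwiseDisjoint hne
  have h0 := Submodule.disjoint_def.1 hd _ (one i hi) (one k hk)
  have := (hI i).1
  obtain ⟨v, hv⟩ := exists_ne (0 : (S i).toSubmodule)
  have hv' : (v : WX n j → ℂ) ≠ 0 := fun h => hv (Subtype.ext h)
  obtain ⟨x, hx⟩ := Function.ne_iff.1 hv'
  have := congrFun h0 x
  simp at this

lemma wbound {n j : ℕ} (hn : 5 ≤ n) (hj : j ≤ n) (Q R : Equiv.Perm (Fin n)) :
    ∑ b, ∑ a, ((Finset.univ.filter fun x : WX n j => wact (a * b * a⁻¹ * Q * b⁻¹ * R) x = x).card : ℝ)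
      ≤ 5 * (n.factorial : ℝ) ^ 2 := by
  classical
  obtain ⟨p, hp, hp1, hp2⟩ := Nat.exists_prime_lt_and_le_two_mul (n / 2) (by omega)
  have hp3 : 3 ≤ p := by omega
  have hpn : p ≤ n := by omega
  have hpn2 : n + 1 ≤ 2 * p := by omega
  obtain ⟨m, S, hS, hI⟩ := wdecomp (wrep n j)
  have h1 := wtotal (wrep n j) S hS hI Q R
  have hm := wcount S hS hI
  simp only [wtrace] at h1
  have h2 : ‖∑ b, ∑ a, ((Finset.univ.filter fun x : WX n j => wact (a * b * a⁻¹ * Q * b⁻¹ * R) x = x).card : ℂ)‖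
    = ∑ b, ∑ a, ((Finset.univ.filter fun x : WX n j => wact (a * b * a⁻¹ * Q * b⁻¹ * R) x = x).card : ℝ) := by
    have := Complex.norm_natCast (∑ b, ∑ a, (Finset.univ.filter fun x : WX n j => wact (a * b * a⁻¹ * Q * b⁻¹ * R) x = x).card)
    push_cast at this
    exact this
  rw [h2, Fintype.card_perm, Fintype.card_fin] at h1
  refine h1.trans ?_
  rw [mul_comm]
  gcongr
  have hpr : (0 : ℝ) < p - 1 := by
    have : (3 : ℝ) ≤ p := by exact_mod_cast hp3
    linarith
  have hterm : ∀ i : Fin m, 1 / (finrank ℂ (S i).toSubmodule : ℝ) ≤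
      (if finrank ℂ (S i).toSubmodule < p - 1 then 1 else 0) + 1 / ((p : ℝ) - 1) := by
    intro i
    have := (hI i).1
    have hpos : 0 < finrank ℂ (S i).toSubmodule := finrank_pos
    split_ifs with h
    · have : 1 / (finrank ℂ (S i).toSubmodule : ℝ) ≤ 1 := by
        rw [div_le_one (by exact_mod_cast hpos)]
        exact_mod_cast hpos
      have : 0 ≤ 1 / ((p : ℝ) - 1) := by positivity
      linarith
    · rw [zero_add]
      apply one_div_le_one_div_of_le hpr
      have : p ≤ finrank ℂ (S i).toSubmodule + 1 := by omega
      have : (p : ℝ) ≤ finrank ℂ (S i).toSubmodule + 1 := by exact_mod_cast this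
      linarith
  have hs : ∑ i : Fin m, (if finrank ℂ (S i).toSubmodule < p - 1 then (1 : ℝ) else 0) ≤ 1 := by
    rw [Finset.sum_boole]
    have : (Finset.univ.filter fun i : Fin m => finrank ℂ (S i).toSubmodule < p - 1).card ≤ 1 := by
      rw [Finset.card_le_one]
      intro a ha b hb
      exact wonesmall hp hp3 hpn S hS hI a b (Finset.mem_filter.1 ha).2 (Finset.mem_filter.1 hb).2
    exact_mod_cast this
  calc _ ≤ ∑ i : Fin m, ((if finrank ℂ (S i).toSubmodule < p - 1 then (1 : ℝ) else 0) + 1 / ((p : ℝ) - 1)) :=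
        Finset.sum_le_sum fun i _ => hterm i
    _ ≤ 1 + m * (1 / ((p : ℝ) - 1)) := by
        rw [Finset.sum_add_distrib]; simp; simpa using hs
    _ ≤ 5 := by
        have h3 : (m : ℝ) ≤ 4 * ((p : ℝ) - 1) := by
          have : m + 4 ≤ 4 * p := by omega
          have : (m : ℝ) + 4 ≤ 4 * p := by exact_mod_cast this
          linarith
        rw [mul_one_div]
        have : (m : ℝ) / (p - 1) ≤ 4 := by rw [div_le_iff₀ hpr]; exact h3
        linarith

end PartC

section PartD

lemma wpow {n : ℕ} (w : Equiv.Perm (Fin n)) :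
    2 ^ numCycles w ≤ (Finset.univ.filter fun x : Fin n → Bool => ∀ i, x (w i) = x i).card := by
  classical
  let A := (w.cycleFactorsFinset → Bool) × ({i : Fin n // w i = i} → Bool)
  have hA : Fintype.card A = 2 ^ numCycles w := by
    simp only [A, Fintype.card_prod, Fintype.card_fun, Fintype.card_bool, Fintype.card_coe,
      Fintype.card_subtype, numCycles, pow_add]
    congr 2
    rw [Equiv.Perm.cycleType_def]; simp
  rw [← hA, ← Finset.card_univ]
  let f : A → (Fin n → Bool) := fun a i =>
    if h : w i = i then a.2 ⟨i, h⟩ else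
      a.1 ⟨w.cycleOf i, Equiv.Perm.cycleOf_mem_cycleFactorsFinset_iff.2 (Equiv.Perm.mem_support.2 h)⟩
  refine Finset.card_le_card_of_injOn f ?_ ?_
  · intro a _
    simp only [Finset.coe_filter, Finset.mem_univ, true_and, Set.mem_setOf_eq]
    intro i
    by_cases h : w i = i
    · rw [h]
    · have h' : w (w i) ≠ w i := fun h2 => h (w.injective h2)
      simp only [f, dif_neg h, dif_neg h']
      refine congrArg a.1 (Subtype.ext ?_)
      exact (Equiv.Perm.SameCycle.cycleOf_eq (Equiv.Perm.sameCycle_apply_left.2 (Equiv.Perm.SameCycle.refl w i)))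
  · rintro ⟨a1, a2⟩ _ ⟨b1, b2⟩ _ hab
    refine Prod.ext ?_ ?_
    · funext ⟨c, hc⟩
      have hc' := Equiv.Perm.mem_cycleFactorsFinset_iff.1 hc
      obtain ⟨i, hi, -⟩ := hc'.1
      have hic : i ∈ c.support := Equiv.Perm.mem_support.2 hi
      have hcw : c = w.cycleOf i := Equiv.Perm.cycle_is_cycleOf hic hc
      have hwi : w i ≠ i := by rw [← hc'.2 i hic]; exact hi
      have := congrFun hab i
      simp only [f, dif_neg hwi] at this
      simp only [hcw]
      exact this
    · funext ⟨i, hi⟩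
      have := congrFun hab i
      simpa only [f, dif_pos hi] using this

lemma wfixsum {n : ℕ} (w : Equiv.Perm (Fin n)) :
    (Finset.univ.filter fun x : Fin n → Bool => ∀ i, x (w i) = x i).card =
      ∑ j ∈ Finset.range (n + 1), (Finset.univ.filter fun x : WX n j => wact w x = x).card := by
  classical
  rw [Finset.card_eq_sum_card_fiberwise (f := fun x : Fin n → Bool => (Finset.univ.filter fun i => x i = true).card)
    (t := Finset.range (n + 1))]
  · refine Finset.sum_congr rfl fun j _ => ?_
    symm
    refine Finset.card_bij (fun x _ => x.1) ?_ ?_ ?_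
    · intro x hx
      simp only [Finset.mem_filter, Finset.mem_univ, true_and] at hx ⊢
      exact ⟨fun i => congrFun (congrArg Subtype.val hx) i, x.2⟩
    · intro x _ y _ h
      exact Subtype.ext h
    · intro x hx
      simp only [Finset.mem_filter, Finset.mem_univ, true_and] at hx
      refine ⟨⟨x, hx.2⟩, ?_, rfl⟩
      simp only [Finset.mem_filter, Finset.mem_univ, true_and]
      exact Subtype.ext (funext hx.1)
  · intro x _
    simp only [Finset.coe_range, Set.mem_Iio]
    have := Finset.card_le_univ (Finset.univ.filter fun i => x i = true)
    simp at this
    exact Nat.lt_succ_of_le this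

lemma wexp {n : ℕ} (hn : 1 ≤ n) (Q R : Equiv.Perm (Fin n)) :
    ∑ b, ∑ a, (2 : ℝ) ^ numCycles (a * b * a⁻¹ * Q * b⁻¹ * R) ≤ 16 * n * (n.factorial : ℝ) ^ 2 := by
  classical
  have hn1 : (1 : ℝ) ≤ n := by exact_mod_cast hn
  have hle : ∀ w : Equiv.Perm (Fin n), (2 : ℝ) ^ numCycles w ≤
      ∑ j ∈ Finset.range (n + 1), ((Finset.univ.filter fun x : WX n j => wact w x = x).card : ℝ) := by
    intro w
    have := wpow w
    rw [wfixsum] at this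
    exact_mod_cast this
  rcases Nat.lt_or_ge n 5 with h5 | h5
  · have hw : ∀ w : Equiv.Perm (Fin n), (2 : ℝ) ^ numCycles w ≤ 16 := by
      intro w
      have h1 := wpow w
      have h2 := Finset.card_le_univ (Finset.univ.filter fun x : Fin n → Bool => ∀ i, x (w i) = x i)
      have h3 : Fintype.card (Fin n → Bool) = 2 ^ n := by simp
      have h4 : 2 ^ n ≤ 2 ^ 4 := Nat.pow_le_pow_right (by norm_num) (by omega)
      have : 2 ^ numCycles w ≤ 16 := by omega
      exact_mod_cast this
    calc _ ≤ ∑ b : Equiv.Perm (Fin n), ∑ a : Equiv.Perm (Fin n), (16 : ℝ) :=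
          Finset.sum_le_sum fun b _ => Finset.sum_le_sum fun a _ => hw _
      _ = 16 * 1 * (n.factorial : ℝ) ^ 2 := by
          simp [Fintype.card_perm]; ring
      _ ≤ _ := by gcongr
  · calc _ ≤ ∑ b : Equiv.Perm (Fin n), ∑ a : Equiv.Perm (Fin n), ∑ j ∈ Finset.range (n + 1),
            ((Finset.univ.filter fun x : WX n j => wact (a * b * a⁻¹ * Q * b⁻¹ * R) x = x).card : ℝ) :=
          Finset.sum_le_sum fun b _ => Finset.sum_le_sum fun a _ => hle _
      _ = ∑ j ∈ Finset.range (n + 1), ∑ b : Equiv.Perm (Fin n), ∑ a : Equiv.Perm (Fin n),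
            ((Finset.univ.filter fun x : WX n j => wact (a * b * a⁻¹ * Q * b⁻¹ * R) x = x).card : ℝ) := by
          rw [Finset.sum_comm]
          conv_rhs => rw [Finset.sum_comm]
          rw [Finset.sum_comm]
          refine Finset.sum_congr rfl fun b _ => ?_
          rw [Finset.sum_comm]
      _ ≤ ∑ j ∈ Finset.range (n + 1), 5 * (n.factorial : ℝ) ^ 2 :=
          Finset.sum_le_sum fun j hj => wbound h5 (by rw [Finset.mem_range] at hj; omega) Q R
      _ = (5 * (n + 1)) * (n.factorial : ℝ) ^ 2 := by simp; ring
      _ ≤ _ := by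
          refine mul_le_mul_of_nonneg_right ?_ (by positivity)
          linarith

lemma wall {n : ℕ} (hn : 1 ≤ n) (k : ℕ) :
    ∑ v : Fin (k + 2) → Equiv.Perm (Fin n), (2 : ℝ) ^ numCycles (wc v) ≤
      16 * n * (n.factorial : ℝ) ^ (k + 2) := by
  classical
  have h1 : ∑ v : Fin (k + 2) → Equiv.Perm (Fin n), (2 : ℝ) ^ numCycles (wc v) =
      ∑ u : Fin k → Equiv.Perm (Fin n), ∑ b, ∑ a, (2 : ℝ) ^ numCycles
        (a * b * a⁻¹ * (List.ofFn u).prod * b⁻¹ * (List.ofFn fun i => (u i)⁻¹).prod) := by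
    rw [← Equiv.sum_comp (Fin.consEquiv fun _ => Equiv.Perm (Fin n)), Fintype.sum_prod_type_right]
    rw [← Equiv.sum_comp (Fin.consEquiv fun _ => Equiv.Perm (Fin n)), Fintype.sum_prod_type_right]
    refine Finset.sum_congr rfl fun u _ => ?_
    rw [← Equiv.sum_comp (Equiv.mulRight ((List.ofFn u).prod)⁻¹)]
    refine Finset.sum_congr rfl fun b _ => Finset.sum_congr rfl fun a _ => ?_
    congr 2
    simp only [wc, Fin.consEquiv, Equiv.coe_fn_mk, List.ofFn_succ, Fin.cons_zero, Fin.cons_succ,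
      List.prod_cons, Equiv.coe_mulRight]
    group
  rw [h1]
  calc _ ≤ ∑ u : Fin k → Equiv.Perm (Fin n), 16 * n * (n.factorial : ℝ) ^ 2 :=
        Finset.sum_le_sum fun u _ => wexp hn _ _
    _ = _ := by simp [Fintype.card_perm]; ring

end PartD

/-- Large deviations for the number of cycles of `w_c(σ_1,…,σ_k)`:
`Pr[C(w_c) ≥ t] = O(n/2^t)`. -/
theorem wc_cycle_large_deviation (k : ℕ) (hk : 2 ≤ k) :
    ∃ C > (0 : ℝ), ∀ n ≥ 1, ∀ t : ℕ,
      (Nat.card {v : Fin k → Equiv.Perm (Fin n) // t ≤ numCycles (wc v)} : ℝ)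
        ≤ C * n * (n.factorial : ℝ) ^ k / 2 ^ t := by
  classical
  obtain ⟨k, rfl⟩ : ∃ k', k = k' + 2 := ⟨k - 2, by omega⟩
  refine ⟨16, by norm_num, fun n hn t => ?_⟩
  rw [le_div_iff₀ (by positivity)]
  refine le_trans ?_ (wall hn k)
  rw [Nat.card_eq_fintype_card, Fintype.card_subtype]
  calc _ = ∑ v ∈ Finset.univ.filter (fun v : Fin (k + 2) → Equiv.Perm (Fin n) => t ≤ numCycles (wc v)),
        (2 : ℝ) ^ t := by simp
    _ ≤ ∑ v ∈ Finset.univ.filter (fun v : Fin (k + 2) → Equiv.Perm (Fin n) => t ≤ numCycles (wc v)),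
        (2 : ℝ) ^ numCycles (wc v) := by
        refine Finset.sum_le_sum fun v hv => ?_
        exact pow_le_pow_right₀ (by norm_num) (Finset.mem_filter.1 hv).2
    _ ≤ _ := Finset.sum_le_sum_of_subset_of_nonneg (Finset.filter_subset _ _) (fun _ _ _ => by positivity)
end
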